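/- arXiv:2306.06588 — 4 statements merged into one kernel-verified Lean document; each statement's English description precedes it below -/
import Mathlib

section
/- If p does not divide k and q ≥ k^3 − 3k^2 + 3k, then every matrix in M_n(𝔽_q) can be written as A^k + B^k with A, B ∈ M_n(𝔽_q). -/
namespace SumPow
open Finset

/-- The exponential sum attached to `x ↦ x ^ k`. -/
noncomputable def S {F : Type*} [Field F] [Fintype F] (ψ : AddChar F ℂ) (k : ℕ) (b : F) : ℂ :=
  ∑ x : F, ψ (b * x ^ k)

open Classical in
/-- Number of `k`-th roots of unity. -/
noncomputable def rt (F : Type*) [Field F] [Fintype F] (k : ℕ) : ℕ :=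
  #{x : F | x ^ k = 1}

open Classical in
lemma orth {F : Type*} [Field F] [Fintype F] {ψ : AddChar F ℂ} (hψ : ψ.IsPrimitive)
    {ι : Type*} [Fintype ι] (g : ι → F) :
    ∑ b : F, ∑ i, ψ (b * g i) = (Fintype.card F : ℂ) * (#{i | g i = 0} : ℕ) := by
  rw [Finset.sum_comm]
  simp_rw [AddChar.sum_mulShift _ hψ]
  push_cast
  rw [Finset.sum_ite]
  simp [mul_comm]

lemma S_zero {F : Type*} [Field F] [Fintype F] (ψ : AddChar F ℂ) (k : ℕ) :
    S ψ k 0 = Fintype.card F := by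
  simp [S]

lemma rt_le (F : Type*) [Field F] [Fintype F] {k : ℕ} (hk : 1 ≤ k) : rt F k ≤ k := by
  classical
  have : ({x : F | x ^ k = 1} : Finset F) ⊆ Polynomial.nthRootsFinset k (1 : F) := by
    intro x hx
    rw [Polynomial.mem_nthRootsFinset hk]
    simpa using hx
  refine (card_le_card (by convert this)).trans ?_
  exact (Multiset.toFinset_card_le _).trans (Polynomial.card_nthRoots k 1)

lemma rt_pos (F : Type*) [Field F] [Fintype F] (k : ℕ) : 1 ≤ rt F k := by
  classical
  exact card_pos.mpr ⟨1, by simp⟩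

open Classical in
lemma card_pairs (F : Type*) [Field F] [Fintype F] {k : ℕ} (hk : 1 ≤ k) {c : F} (hc : c ≠ 0) :
    (#{z : F × F | z.1 ^ k = c * z.2 ^ k} : ℤ) ≤ 1 + (Fintype.card F - 1) * rt F k := by
  have h1 : (#{z : F × F | z.1 ^ k = c * z.2 ^ k}) = ∑ y : F, #{x : F | x ^ k = c * y ^ k} := by
    rw [Finset.card_filter, Fintype.sum_prod_type_right]
    simp_rw [Finset.card_filter]
  rw [h1, ← Finset.add_sum_erase _ _ (mem_univ (0 : F))]
  have h0 : #{x : F | x ^ k = c * 0 ^ k} = 1 := by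
    rw [card_eq_one]
    refine ⟨0, ?_⟩
    ext x
    have : k ≠ 0 := by lia
    simp [this]
  have h2 : ∀ y ∈ univ.erase (0 : F), #{x : F | x ^ k = c * y ^ k} ≤ rt F k := by
    intro y hy
    have hy : y ≠ 0 := by simpa using hy
    by_cases hne : ∃ x₀ : F, x₀ ^ k = c * y ^ k
    · obtain ⟨x₀, hx₀⟩ := hne
      have hx0 : x₀ ≠ 0 := by
        rintro rfl
        rw [zero_pow (by lia)] at hx₀
        exact (mul_ne_zero hc (pow_ne_zero _ hy)) hx₀.symm
      refine card_le_card_of_injOn (fun x => x / x₀) ?_ ?_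
      · intro x hx
        simp only [coe_filter, mem_univ, true_and, Set.mem_ofPred_eq] at hx ⊢
        rw [div_pow, hx, hx₀, div_self (mul_ne_zero hc (pow_ne_zero _ hy))]
      · intro a _ b _ h
        exact (div_left_inj' hx0).mp h
    · push Not at hne
      simp [hne]
  have h3 := Finset.sum_le_card_nsmul _ _ _ h2
  rw [card_erase_of_mem (mem_univ _), card_univ, smul_eq_mul] at h3
  rw [h0]
  have : 1 ≤ Fintype.card F := Fintype.card_pos
  have h4 : ((∑ y ∈ univ.erase (0 : F), #{x : F | x ^ k = c * y ^ k} : ℕ) : ℤ)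
      ≤ ((Fintype.card F - 1 : ℕ) : ℤ) * rt F k := by exact_mod_cast h3
  push_cast [this] at h4 ⊢
  linarith

/-- second moment, over all nonzero frequencies -/
lemma second {F : Type*} [Field F] [Fintype F] [DecidableEq F] {ψ : AddChar F ℂ}
    (hψ : ψ.IsPrimitive) {k : ℕ} (hk : 1 ≤ k) :
    ∑ b ∈ univ.erase (0 : F), ‖S ψ k b‖ ^ 2 ≤
      (Fintype.card F : ℝ) * (Fintype.card F - 1) * (rt F k - 1) := by
  classical
  have h1 : ∑ b : F, ((‖S ψ k b‖ ^ 2 : ℝ) : ℂ) =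
      (Fintype.card F : ℂ) * (#{z : F × F | z.1 ^ k - z.2 ^ k = 0} : ℕ) := by
    have ho := orth hψ (fun z : F × F => z.1 ^ k - z.2 ^ k)
    refine Eq.trans ?_ (ho.trans (by congr!))
    refine sum_congr rfl fun b _ => ?_
    push_cast
    rw [← Complex.mul_conj', S, map_sum, Finset.sum_mul_sum, Fintype.sum_prod_type]
    refine sum_congr rfl fun x _ => sum_congr rfl fun y _ => ?_
    rw [← AddChar.map_neg_eq_conj, ← AddChar.map_add_eq_mul]
    congr 1
    ring
  have h2 : ∑ b : F, ‖S ψ k b‖ ^ 2 =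
      (Fintype.card F : ℝ) * (#{z : F × F | z.1 ^ k - z.2 ^ k = 0} : ℕ) := by
    exact_mod_cast h1
  rw [← Finset.add_sum_erase _ _ (mem_univ (0 : F)), S_zero] at h2
  have h3 := card_pairs F hk (one_ne_zero)
  simp_rw [one_mul, ← sub_eq_zero (b := _ ^ k)] at h3
  have h4 : (#{z : F × F | z.1 ^ k - z.2 ^ k = 0} : ℝ) ≤ 1 + (Fintype.card F - 1) * rt F k := by
    exact_mod_cast h3
  have h5 := mul_le_mul_of_nonneg_left h4 (Nat.cast_nonneg (α := ℝ) (Fintype.card F))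
  simp only [Complex.norm_natCast] at h2
  linarith

lemma S_smul {F : Type*} [Field F] [Fintype F] (ψ : AddChar F ℂ) (k : ℕ) (b u : F)
    (hu : u ≠ 0) : S ψ k (b * u ^ k) = S ψ k b := by
  unfold S
  refine Fintype.sum_equiv (Equiv.mulLeft₀ u hu) _ _ fun x => ?_
  simp [mul_pow, mul_assoc]

open Classical in
lemma sup_bound {F : Type*} [Field F] [Fintype F] {ψ : AddChar F ℂ}
    (hψ : ψ.IsPrimitive) {k : ℕ} (hk : 1 ≤ k) {c : F} (hc : c ≠ 0) :
    ‖S ψ k c‖ ^ 2 ≤ (Fintype.card F : ℝ) * (rt F k - 1) ^ 2 := by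
  set q : ℝ := ((Fintype.card F : ℕ) : ℝ) with hq
  have hk0 : k ≠ 0 := by lia
  have hq1 : 1 < q := by rw [hq]; exact_mod_cast Fintype.one_lt_card
  let f : F → ℝ := fun b => (#{x : F | c * x ^ k = b} : ℕ)
  have hS1 : ∑ b : F, S ψ k b = q := by
    have := orth hψ (fun x : F => x ^ k)
    have h1 : #{i : F | i ^ k = 0} = 1 := by
      rw [card_eq_one]
      refine ⟨0, ?_⟩
      ext x
      simp [hk0]
    rw [h1] at this
    simpa [S, hq] using this
  have hf0 : f 0 = 1 := by
    simp only [f]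
    norm_cast
    rw [card_eq_one]
    refine ⟨0, ?_⟩
    ext x
    simp [hk0, hc]
  have hfS : ∑ b : F, (f b : ℂ) * S ψ k b = q + (q - 1) * S ψ k c := by
    have : ∀ b : F, (f b : ℂ) * S ψ k b = ∑ x : F, if c * x ^ k = b then S ψ k b else 0 := by
      intro b
      rw [← sum_filter, sum_const]
      simp [f]
    simp_rw [this]
    rw [sum_comm]
    simp only [sum_ite_eq, mem_univ, if_true]
    rw [← Finset.add_sum_erase _ _ (mem_univ (0 : F))]
    rw [sum_congr rfl (g := fun _ => S ψ k c)]
    · rw [sum_const, card_erase_of_mem (mem_univ _), card_univ]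
      have : 1 ≤ Fintype.card F := Fintype.card_pos
      simp [hk0, S_zero, hq, Nat.cast_sub this]
    · intro x hx
      exact S_smul _ _ _ _ (by simpa using hx)
  have hmain : ∑ b ∈ univ.erase (0 : F), ((f b - 1 : ℝ) : ℂ) * S ψ k b = (q - 1) * S ψ k c := by
    have h : ∑ b : F, ((f b - 1 : ℝ) : ℂ) * S ψ k b = (q - 1) * S ψ k c := by
      push_cast
      simp_rw [sub_mul, one_mul]
      rw [sum_sub_distrib, hfS, hS1]
      ring
    rw [← h, ← Finset.add_sum_erase _ _ (mem_univ (0 : F)), hf0]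
    simp
  have hf1 : ∑ b : F, f b = q := by
    simp only [f]
    rw [hq, ← card_univ, card_eq_sum_card_fiberwise (f := fun x : F => c * x ^ k) (t := univ)
      (by simp)]
    push_cast
    rfl
  have hf2 : ∑ b : F, f b ^ 2 ≤ 1 + (q - 1) * rt F k := by
    have h3 := card_pairs F hk (one_ne_zero)
    have h4 : (#{z : F × F | z.1 ^ k = 1 * z.2 ^ k} : ℝ) ≤ 1 + (q - 1) * rt F k := by
      rw [hq]
      exact_mod_cast h3
    refine le_trans (le_of_eq ?_) h4
    have : #{z : F × F | z.1 ^ k = 1 * z.2 ^ k} = ∑ b : F, #{x : F | c * x ^ k = b} ^ 2 := by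
      rw [card_eq_sum_card_fiberwise (f := fun z : F × F => c * z.1 ^ k) (t := univ) (by simp)]
      refine sum_congr rfl fun b _ => ?_
      rw [sq, ← card_product]
      congr 1
      ext ⟨x, y⟩
      simp only [mem_filter, mem_univ, true_and, mem_product, one_mul]
      constructor
      · rintro ⟨h, h'⟩
        exact ⟨h', by rw [← h, h']⟩
      · rintro ⟨h, h'⟩
        exact ⟨mul_left_cancel₀ hc (h.trans h'.symm), h⟩
    rw [this]
    push_cast
    rfl
  have hf3 : ∑ b ∈ univ.erase (0 : F), (f b - 1) ^ 2 ≤ (q - 1) * (rt F k - 1) := by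
    have h : ∑ b : F, (f b - 1) ^ 2 = ∑ b : F, f b ^ 2 - 2 * ∑ b : F, f b + q := by
      simp_rw [sub_sq, sum_add_distrib, sum_sub_distrib, mul_sum]
      simp [hq]
    have h' : ∑ b ∈ univ.erase (0 : F), (f b - 1) ^ 2 ≤ ∑ b : F, (f b - 1) ^ 2 :=
      sum_le_sum_of_subset_of_nonneg (erase_subset _ _) (fun _ _ _ => sq_nonneg _)
    rw [h, hf1] at h'
    linarith
  have hsec := second hψ hk
  have hn : (q - 1) * ‖S ψ k c‖ ≤ ∑ b ∈ univ.erase (0 : F), |f b - 1| * ‖S ψ k b‖ := by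
    have := norm_sum_le (univ.erase (0 : F)) (fun b => ((f b - 1 : ℝ) : ℂ) * S ψ k b)
    rw [hmain, norm_mul] at this
    simp only [norm_mul, Complex.norm_real, Real.norm_eq_abs] at this
    refine le_trans (le_of_eq ?_) this
    congr 1
    rw [← Complex.ofReal_one, ← Complex.ofReal_sub, Complex.norm_real, Real.norm_eq_abs,
      abs_of_pos (by linarith)]
  have hcs := Finset.sum_mul_sq_le_sq_mul_sq (univ.erase (0 : F)) (fun b => |f b - 1|)
    (fun b => ‖S ψ k b‖)
  simp only [sq_abs] at hcs
  have h6 : ((q - 1) * ‖S ψ k c‖) ^ 2 ≤ ((q - 1) * (rt F k - 1)) * (q * (q - 1) * (rt F k - 1)) := by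
    refine (pow_le_pow_left₀ (by positivity [sub_pos.mpr hq1]) hn 2).trans (hcs.trans ?_)
    have h0 : (1 : ℝ) ≤ rt F k := by exact_mod_cast rt_pos F k
    exact mul_le_mul hf3 hsec (sum_nonneg fun _ _ => by positivity)
      (mul_nonneg (by linarith) (by linarith))
  have h7 : 0 < (q - 1) ^ 2 := by have := sub_pos.mpr hq1; positivity
  refine le_of_mul_le_mul_left ?_ h7
  nlinarith [h6]

open Classical in
/-- four powers -/
lemma four {F : Type*} [Field F] [Fintype F] {k : ℕ} (hk : 1 ≤ k)
    (hq : ((rt F k : ℝ) - 1) ^ 3 + 1 ≤ Fintype.card F) (hq3 : 3 ≤ Fintype.card F) (t : F) :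
    ∃ x₀ x₁ y₀ y₁ : F, x₀ ≠ 0 ∧ y₀ ≠ 0 ∧ x₀ ^ k + x₁ ^ k + y₀ ^ k + y₁ ^ k = t := by
  by_contra hcon
  push Not at hcon
  obtain ⟨ψ, hψ⟩ : ∃ ψ : AddChar F ℂ, ψ.IsPrimitive :=
    ⟨_, AddChar.FiniteField.primitiveChar_to_Complex_isPrimitive F⟩
  let T : Finset (F × F × F × F) := {z | z.1 ^ k + z.2.1 ^ k + z.2.2.1 ^ k + z.2.2.2 ^ k - t = 0}
  set q : ℝ := ((Fintype.card F : ℕ) : ℝ) with hqd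
  have hT : (#T : ℝ) ≤ 4 * q := by
    let U : Finset (F × F × F × F) :=
      univ.image (fun x : F => (x, 0, 0, 0)) ∪ univ.image (fun x : F => (0, x, 0, 0)) ∪
      (univ.image (fun x : F => (0, 0, x, 0)) ∪ univ.image (fun x : F => (0, 0, 0, x)))
    have hTU : T ⊆ U := by
      rintro ⟨a, b, c, d⟩ hz
      have hz : a ^ k + b ^ k + c ^ k + d ^ k = t := by
        simpa [T, sub_eq_zero] using hz
      have h1 := hcon a b c d
      have h2 := hcon a b d c
      have h3 := hcon a c b d
      have h4 := hcon b a c d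
      have h5 := hcon b a d c
      have h6 := hcon c a d b
      simp only [U, mem_union, mem_image, mem_univ, true_and, Prod.mk.injEq]
      by_cases ha : a = 0 <;> by_cases hb : b = 0 <;> by_cases hc : c = 0 <;>
        by_cases hd : d = 0 <;> grind
    have hU : #U ≤ 4 * Fintype.card F := by
      refine (card_union_le _ _).trans ?_
      have h1 := card_union_le (univ.image (fun x : F => ((x, 0, 0, 0) : F × F × F × F)))
        (univ.image (fun x : F => ((0, x, 0, 0) : F × F × F × F)))
      have h2 := card_union_le (univ.image (fun x : F => ((0, 0, x, 0) : F × F × F × F)))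
        (univ.image (fun x : F => ((0, 0, 0, x) : F × F × F × F)))
      have a1 := card_image_le (s := univ) (f := fun x : F => ((x, 0, 0, 0) : F × F × F × F))
      have a2 := card_image_le (s := univ) (f := fun x : F => ((0, x, 0, 0) : F × F × F × F))
      have a3 := card_image_le (s := univ) (f := fun x : F => ((0, 0, x, 0) : F × F × F × F))
      have a4 := card_image_le (s := univ) (f := fun x : F => ((0, 0, 0, x) : F × F × F × F))
      rw [card_univ] at a1 a2 a3 a4
      lia
    have := (card_le_card hTU).trans hU
    rw [hqd]
    exact_mod_cast this
  have hsum : ∑ b : F, S ψ k b ^ 4 * ψ (b * (-t)) = q * #T := by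
    have := orth hψ (fun z : F × F × F × F =>
      z.1 ^ k + z.2.1 ^ k + z.2.2.1 ^ k + z.2.2.2 ^ k - t)
    refine Eq.trans ?_ (this.trans (by simp [hqd, T]))
    refine sum_congr rfl fun b _ => ?_
    rw [show S ψ k b ^ 4 = S ψ k b * (S ψ k b * (S ψ k b * S ψ k b)) by ring]
    simp only [S, Fintype.sum_prod_type]
    simp only [sum_mul, mul_sum]
    refine sum_congr rfl fun x _ => sum_congr rfl fun y _ => sum_congr rfl fun z _ =>
      sum_congr rfl fun w _ => ?_
    simp only [← AddChar.map_add_eq_mul]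
    congr 1
    ring
  have herr : ‖∑ b ∈ univ.erase (0 : F), S ψ k b ^ 4 * ψ (b * (-t))‖ ≤
      (q * (rt F k - 1) ^ 2) * (q * (q - 1) * (rt F k - 1)) := by
    refine (norm_sum_le _ _).trans ?_
    refine le_trans (sum_le_sum (g := fun b => (q * (rt F k - 1) ^ 2) * ‖S ψ k b‖ ^ 2) ?_) ?_
    · intro b hb
      have hb : b ≠ 0 := by simpa using hb
      have := sup_bound hψ hk hb
      rw [norm_mul, AddChar.norm_apply, mul_one, norm_pow]
      nlinarith [sq_nonneg ‖S ψ k b‖]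
    · rw [← mul_sum]
      exact mul_le_mul_of_nonneg_left (second hψ hk) (by positivity)
  rw [← Finset.add_sum_erase _ _ (mem_univ (0 : F)), S_zero] at hsum
  simp only [zero_mul, AddChar.map_zero_eq_one, mul_one] at hsum
  have hq3' : (3 : ℝ) ≤ q := by rw [hqd]; exact_mod_cast hq3
  have e : ∑ b ∈ univ.erase (0 : F), S ψ k b ^ 4 * ψ (b * (-t)) = ((q * #T - q ^ 4 : ℝ) : ℂ) := by
    push_cast
    rw [← hsum]
    simp [hqd]
  rw [e, Complex.norm_real, Real.norm_eq_abs] at herr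
  have h1 := (abs_le.mp herr).1
  have h2 : q * #T ≤ q * (4 * q) := mul_le_mul_of_nonneg_left hT (by linarith)
  have h3 : ((rt F k : ℝ) - 1) ^ 3 * (q ^ 2 * (q - 1)) ≤ (q - 1) * (q ^ 2 * (q - 1)) :=
    mul_le_mul_of_nonneg_right (by linarith) (mul_nonneg (sq_nonneg _) (by linarith))
  have h4 : q ^ 4 ≤ 4 * q ^ 2 + (q - 1) * (q ^ 2 * (q - 1)) := by nlinarith
  have h5 : q ^ 2 * (2 * q - 5) ≤ 0 := by nlinarith
  have h6 : 0 < q ^ 2 * (2 * q - 5) := mul_pos (by positivity) (by linarith)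
  linarith

open Classical in
/-- two powers in a large field -/
lemma two {F : Type*} [Field F] [Fintype F] {k : ℕ} (hk : 1 ≤ k)
    (hq : (((rt F k : ℝ) - 1) ^ 3 + 1) ^ 2 ≤ Fintype.card F) (t : F) :
    ∃ x y : F, x ^ k + y ^ k = t := by
  have hk0 : k ≠ 0 := by lia
  by_cases ht : t = 0
  · exact ⟨0, 0, by simp [hk0, ht]⟩
  by_contra hcon
  push Not at hcon
  obtain ⟨ψ, hψ⟩ : ∃ ψ : AddChar F ℂ, ψ.IsPrimitive :=
    ⟨_, AddChar.FiniteField.primitiveChar_to_Complex_isPrimitive F⟩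
  set q : ℝ := ((Fintype.card F : ℕ) : ℝ) with hqd
  let T : Finset (F × F × F) := {z | z.1 ^ k + z.2.1 ^ k - t * z.2.2 ^ k = 0}
  have hT : (#T : ℝ) ≤ 1 + (q - 1) * rt F k := by
    have h1 := card_pairs F hk (neg_ne_zero.mpr (one_ne_zero (α := F)))
    have h2 : #T ≤ #{z : F × F | z.1 ^ k = -1 * z.2 ^ k} := by
      have hc : ∀ z ∈ T, z.2.2 = 0 ∧ z.1 ^ k = -1 * z.2.1 ^ k := by
        rintro ⟨a, b, c⟩ h
        have h : a ^ k + b ^ k - t * c ^ k = 0 := by simpa [T] using h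
        have hc : c = 0 := by
          by_contra hc
          apply hcon (a / c) (b / c)
          rw [div_pow, div_pow, ← add_div, div_eq_iff (pow_ne_zero _ hc)]
          linear_combination h
        rw [hc, zero_pow hk0] at h
        exact ⟨hc, by linear_combination h⟩
      refine card_le_card_of_injOn (fun z => (z.1, z.2.1)) ?_ ?_
      · intro z hz
        simpa using (hc z hz).2
      · rintro ⟨a, b, c⟩ h ⟨a', b', c'⟩ h' hh
        have e1 := (hc _ h).1
        have e2 := (hc _ h').1
        simp only [Prod.mk.injEq] at hh e1 e2 ⊢
        exact ⟨hh.1, hh.2, e1.trans e2.symm⟩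
    have h3 : (#{z : F × F | z.1 ^ k = -1 * z.2 ^ k} : ℝ) ≤ 1 + (q - 1) * rt F k := by
      rw [hqd]
      exact_mod_cast h1
    exact le_trans (by exact_mod_cast h2) h3
  have hsum : ∑ b : F, S ψ k b ^ 2 * S ψ k (b * -t) = q * #T := by
    have := orth hψ (fun z : F × F × F => z.1 ^ k + z.2.1 ^ k - t * z.2.2 ^ k)
    refine Eq.trans ?_ (this.trans (by simp [hqd, T]))
    refine sum_congr rfl fun b _ => ?_
    rw [show S ψ k b ^ 2 * S ψ k (b * -t) = S ψ k b * (S ψ k b * S ψ k (b * -t)) by ring]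
    simp only [S, Fintype.sum_prod_type]
    rw [sum_mul]
    refine sum_congr rfl fun x _ => ?_
    rw [sum_mul, mul_sum]
    refine sum_congr rfl fun y _ => ?_
    rw [mul_sum, mul_sum]
    refine sum_congr rfl fun z _ => ?_
    simp only [← AddChar.map_add_eq_mul]
    congr 1
    ring
  have hr1 : (1 : ℝ) ≤ rt F k := by exact_mod_cast rt_pos F k
  have hq1 : 1 < q := by rw [hqd]; exact_mod_cast Fintype.one_lt_card
  set s := √q with hs
  have hsq : s ^ 2 = q := Real.sq_sqrt (by linarith)
  have hs0 : 0 ≤ s := Real.sqrt_nonneg _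
  have herr : ‖∑ b ∈ univ.erase (0 : F), S ψ k b ^ 2 * S ψ k (b * -t)‖ ≤
      (s * (rt F k - 1)) * (q * (q - 1) * (rt F k - 1)) := by
    refine (norm_sum_le _ _).trans ?_
    refine le_trans (sum_le_sum (g := fun b => (s * (rt F k - 1)) * ‖S ψ k b‖ ^ 2) ?_) ?_
    · intro b hb
      have hb : b ≠ 0 := by simpa using hb
      have := sup_bound hψ hk (mul_ne_zero hb (neg_ne_zero.mpr ht))
      have h2 : ‖S ψ k (b * -t)‖ ≤ s * (rt F k - 1) := by
        refine abs_le_of_sq_le_sq' ?_ (mul_nonneg hs0 (by linarith)) |>.2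
        rw [mul_pow, hsq]
        exact this
      rw [norm_mul, norm_pow]
      nlinarith [sq_nonneg ‖S ψ k b‖]
    · rw [← mul_sum]
      exact mul_le_mul_of_nonneg_left (second hψ hk) (mul_nonneg hs0 (by linarith))
  rw [← Finset.add_sum_erase _ _ (mem_univ (0 : F))] at hsum
  simp only [zero_mul, S_zero] at hsum
  have e : ∑ b ∈ univ.erase (0 : F), S ψ k b ^ 2 * S ψ k (b * -t) =
      ((q * #T - q ^ 3 : ℝ) : ℂ) := by
    push_cast
    rw [← hsum]
    simp [hqd]
    ring
  rw [e, Complex.norm_real, Real.norm_eq_abs] at herr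
  have h1 := (abs_le.mp herr).1
  have h2 : q * #T ≤ q * (1 + (q - 1) * rt F k) := mul_le_mul_of_nonneg_left hT (by linarith)
  set e := (rt F k : ℝ) - 1 with he
  have he0 : 0 ≤ e := by linarith
  have hse : e ^ 3 + 1 ≤ s := by
    rw [hs]
    exact Real.le_sqrt_of_sq_le hq
  have hrt : (rt F k : ℝ) = e + 1 := by linarith
  have h3 : q * q ^ 2 ≤ q * (1 + (q - 1) * rt F k + s * e ^ 2 * (q - 1)) := by nlinarith
  have h4 : q ^ 2 ≤ 1 + (q - 1) * rt F k + s * e ^ 2 * (q - 1) :=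
    le_of_mul_le_mul_left h3 (by linarith)
  have h5 : (q - 1) * (q + 1) ≤ (q - 1) * (e + 1 + s * e ^ 2) := by rw [hrt] at h4; nlinarith
  have h6 : q + 1 ≤ e + 1 + s * e ^ 2 := le_of_mul_le_mul_left h5 (by linarith)
  -- e natural, so e = 0 or e ≥ 1
  have hen : e = 0 ∨ 1 ≤ e := by
    rcases Nat.lt_or_ge (rt F k) 2 with h | h
    · left
      have : rt F k = 1 := by have := rt_pos F k; lia
      rw [he, this]; simp
    · right
      have : (2 : ℝ) ≤ rt F k := by exact_mod_cast h
      linarith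
  rcases hen with h | h
  · rw [h] at h6; linarith
  · have h7 : e ^ 2 ≤ e ^ 3 := pow_le_pow_right₀ h (by norm_num)
    have h8 : e ≤ e ^ 3 := by simpa using pow_le_pow_right₀ h (show 1 ≤ 3 by norm_num)
    have h9 : s * (e ^ 2 + 1) ≤ s * s := mul_le_mul_of_nonneg_left (by linarith) hs0
    nlinarith
end SumPow

namespace SumPow
open Finset

section
open Polynomial

lemma rootpoly {F ι : Type*} [Field F] {k : ℕ} (hk : (k : F) ≠ 0) (s : Finset ι)
    (α : ι → F) (hα : ∀ i ∈ s, α i ≠ 0) :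
    ∃ g : F[X], ∏ i ∈ s, (X - C (α i ^ k)) ∣ g ^ k - X := by
  classical
  have hk0 : k ≠ 0 := by rintro rfl; simp at hk
  -- choose roots
  have hr : ∀ a ∈ s.image (fun i => α i ^ k), ∃ r : F, r ≠ 0 ∧ r ^ k = a := by
    intro a ha
    obtain ⟨i, hi, rfl⟩ := mem_image.mp ha
    exact ⟨α i, hα i hi, rfl⟩
  choose! r hr0 hrk using hr
  let g₀ : F[X] := Lagrange.interpolate (s.image (fun i => α i ^ k)) id r
  have hg : ∀ i ∈ s, g₀.eval (α i ^ k) = r (α i ^ k) := by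
    intro i hi
    have := Lagrange.eval_interpolate_at_node (s := s.image (fun i => α i ^ k)) (v := id) r
      Function.injective_id.injOn (mem_image_of_mem _ hi)
    exact this
  set f : F[X] := ∏ i ∈ s, (X - C (α i ^ k)) with hf
  let A := AdjoinRoot f
  let x : A := AdjoinRoot.mk f g₀
  let P : A[X] := X ^ k - C (AdjoinRoot.mk f X)
  have hP : aeval x P = AdjoinRoot.mk f (g₀ ^ k - X) := by
    simp [P, x]
  have hnil : IsNilpotent (aeval x P) := by
    refine ⟨#s, ?_⟩
    rw [hP, ← map_pow, AdjoinRoot.mk_eq_zero, hf, ← prod_const]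
    refine prod_dvd_prod_of_dvd _ _ fun i hi => ?_
    rw [dvd_iff_isRoot]
    simp [hg i hi, hrk _ (mem_image_of_mem _ hi)]
  have hxu : IsUnit x := by
    have hc : IsCoprime f g₀ := by
      rw [hf]
      refine IsCoprime.prod_left fun i hi => ?_
      rw [(irreducible_X_sub_C _).coprime_iff_not_dvd, dvd_iff_isRoot, IsRoot, hg i hi]
      exact hr0 _ (mem_image_of_mem _ hi)
    obtain ⟨u, v, huv⟩ := hc
    refine IsUnit.of_mul_eq_one (AdjoinRoot.mk f v) ?_
    have := congrArg (AdjoinRoot.mk f) huv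
    rw [map_add, map_mul, map_mul, AdjoinRoot.mk_self, mul_zero, zero_add, map_one] at this
    rw [mul_comm]
    exact this
  have hkA : IsUnit ((k : ℕ) : A) := by
    have := (IsUnit.mk0 _ hk).map (algebraMap F A)
    simpa using this
  have hder : IsUnit (aeval x (derivative P)) := by
    simp only [P, derivative_sub, derivative_X_pow, derivative_C, sub_zero, map_mul, map_pow,
      aeval_X, map_natCast]
    exact hkA.mul (hxu.pow _)
  obtain ⟨y, ⟨-, hy⟩, -⟩ := Polynomial.existsUnique_nilpotent_sub_and_aeval_eq_zero hnil hder
  obtain ⟨g, rfl⟩ := AdjoinRoot.mk_surjective y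
  refine ⟨g, ?_⟩
  rw [← AdjoinRoot.mk_eq_zero]
  simpa [P] using hy

lemma rootpoly' {F ι : Type*} [Field F] [Fintype ι] [DecidableEq ι] {k : ℕ} (hk : (k : F) ≠ 0)
    (α : ι → F) (i₀ : ι) (hα : ∀ i, i ≠ i₀ → α i ≠ 0) :
    ∃ g : F[X], ∏ i, (X - C (α i ^ k)) ∣ g ^ k - X := by
  have hk0 : k ≠ 0 := by rintro rfl; simp at hk
  by_cases h0 : α i₀ = 0
  · obtain ⟨g, hg⟩ := rootpoly hk (univ.erase i₀) α (fun i hi => hα i (by simpa using hi))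
    rw [← mul_prod_erase _ _ (mem_univ i₀), h0]
    set f := ∏ i ∈ univ.erase i₀, (X - C (α i ^ k)) with hf
    have hc : IsCoprime (X : F[X]) f := by
      rw [hf]
      refine IsCoprime.prod_right fun i hi => ?_
      rw [irreducible_X.coprime_iff_not_dvd, X_dvd_iff]
      rw [coeff_sub, coeff_X_zero, coeff_C_zero, zero_sub, neg_eq_zero]
      exact pow_ne_zero _ (hα i (by simpa using hi))
    obtain ⟨u, v, huv⟩ := id hc
    refine ⟨g * (u * X), ?_⟩
    rw [zero_pow hk0, C_0, sub_zero]
    refine hc.mul_dvd ?_ ?_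
    · rw [mul_pow, mul_pow]
      refine dvd_sub (dvd_mul_of_dvd_right (dvd_mul_of_dvd_right (dvd_pow_self _ hk0) _) _)
        dvd_rfl
    · have h1 : f ∣ (u * X) ^ k - 1 := by
        refine dvd_trans ?_ (sub_one_dvd_pow_sub_one _ k)
        exact ⟨-v, by linear_combination huv⟩
      have : (g * (u * X)) ^ k - X = g ^ k * ((u * X) ^ k - 1) + (g ^ k - X) := by ring
      rw [this]
      exact dvd_add (dvd_mul_of_dvd_right h1 _) hg
  · refine rootpoly hk univ α fun i _ => ?_
    by_cases h : i = i₀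
    · rw [h]; exact h0
    · exact hα i h

lemma matroot {F ι : Type*} [Field F] [Fintype ι] [DecidableEq ι] {k : ℕ} (hk : (k : F) ≠ 0)
    (α : ι → F) (i₀ : ι) (hα : ∀ i, i ≠ i₀ → α i ≠ 0) (L : Matrix ι ι F)
    (hL : L.charpoly = ∏ i, (X - C (α i ^ k))) : ∃ A : Matrix ι ι F, A ^ k = L := by
  obtain ⟨g, hg⟩ := rootpoly' hk α i₀ hα
  rw [← hL] at hg
  obtain ⟨h, hh⟩ := hg
  refine ⟨aeval L g, ?_⟩
  have := congrArg (aeval L) hh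
  rw [map_mul, Matrix.aeval_self_charpoly, zero_mul, map_sub, map_pow, aeval_X, sub_eq_zero] at this
  exact this

/-- `M` is a sum of two matrices with prescribed split characteristic polynomials. -/
def Sp {F ι : Type*} [Field F] [Fintype ι] [DecidableEq ι] (M : Matrix ι ι F) (a b : ι → F) :
    Prop :=
  ∃ L U : Matrix ι ι F, M = L + U ∧ L.charpoly = ∏ i, (X - C (a i)) ∧
    U.charpoly = ∏ i, (X - C (b i))

lemma Sp.conj {F ι : Type*} [Field F] [Fintype ι] [DecidableEq ι] {M : Matrix ι ι F}
    {a b : ι → F} {P Q : Matrix ι ι F} (hPQ : P * Q = 1) (h : Sp (P * M * Q) a b) : Sp M a b := by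
  obtain ⟨L, U, h1, h2, h3⟩ := h
  have hQP : Q * P = 1 := mul_eq_one_comm.mp hPQ
  refine ⟨Q * L * P, Q * U * P, ?_, ?_, ?_⟩
  · have : M = Q * (P * M * Q) * P := by
      calc M = (Q * P) * M * (Q * P) := by rw [hQP]; simp
        _ = _ := by simp only [mul_assoc]
    rw [this, h1, mul_add, add_mul]
  · rw [Matrix.charpoly_mul_comm, ← mul_assoc, hPQ, one_mul, h2]
  · rw [Matrix.charpoly_mul_comm, ← mul_assoc, hPQ, one_mul, h3]

lemma charpoly_diag {F ι : Type*} [Field F] [Fintype ι] [DecidableEq ι] (a : ι → F) :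
    (Matrix.diagonal a).charpoly = ∏ i, (X - C (a i)) := by
  exact Matrix.charpoly_diagonal a

lemma Sp.one {F ι : Type*} [Field F] [Fintype ι] [DecidableEq ι] (M : Matrix ι ι F)
    (a b : ι → F) [Subsingleton ι] (h : ∀ i, M i i = a i + b i) : Sp M a b := by
  refine ⟨Matrix.diagonal a, Matrix.diagonal b, ?_, charpoly_diag _, charpoly_diag _⟩
  ext i j
  obtain rfl := Subsingleton.elim i j
  simp [h]

lemma Sp.block {F ι κ : Type*} [Field F] [Fintype ι] [DecidableEq ι] [Fintype κ] [DecidableEq κ]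
    {M : Matrix ι ι F} {N : Matrix κ κ F} {a b : ι → F} {c d : κ → F} (h : Sp M a b)
    (h' : Sp N c d) (B : Matrix ι κ F) (D : Matrix κ ι F) :
    Sp (Matrix.fromBlocks M B D N) (Sum.elim a c) (Sum.elim b d) := by
  obtain ⟨L, U, h1, h2, h3⟩ := h
  obtain ⟨L', U', h1', h2', h3'⟩ := h'
  refine ⟨Matrix.fromBlocks L 0 D L', Matrix.fromBlocks U B 0 U', ?_, ?_, ?_⟩
  · rw [Matrix.fromBlocks_add, h1, h1', zero_add, add_zero]
  · rw [Matrix.charpoly_fromBlocks_zero₁₂, h2, h2', Fintype.prod_sum_type]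
    simp
  · rw [Matrix.charpoly_fromBlocks_zero₂₁, h3, h3', Fintype.prod_sum_type]
    simp

lemma Sp.reindex {F ι κ : Type*} [Field F] [Fintype ι] [DecidableEq ι] [Fintype κ] [DecidableEq κ]
    {M : Matrix ι ι F} {a b : ι → F} (e : κ ≃ ι) (h : Sp (M.submatrix e e) (a ∘ e) (b ∘ e)) :
    Sp M a b := by
  obtain ⟨L, U, h1, h2, h3⟩ := h
  refine ⟨Matrix.reindex e e L, Matrix.reindex e e U, ?_, ?_, ?_⟩
  · have := congrArg (fun N => Matrix.submatrix N e.symm e.symm) h1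
    simpa [Matrix.submatrix_add] using this
  · rw [Matrix.charpoly_reindex, h2]
    exact Fintype.prod_equiv e _ _ (fun _ => rfl)
  · rw [Matrix.charpoly_reindex, h3]
    exact Fintype.prod_equiv e _ _ (fun _ => rfl)

lemma Sp.remove {F ι : Type*} [Field F] [Fintype ι] [DecidableEq ι] (M : Matrix ι ι F)
    (a b : ι → F) (i : ι) (h : M i i = a i + b i)
    (h' : Sp (M.submatrix (fun x : {x // ¬ x = i} => (x : ι)) (fun x => (x : ι)))
      (fun x => a x) (fun x => b x)) : Sp M a b := by
  refine Sp.reindex (Equiv.sumCompl (fun x => x = i)) ?_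
  rw [← Matrix.fromBlocks_toBlocks (M.submatrix _ _)]
  have h1 : Sp (M.submatrix (fun x : {x // x = i} => (x : ι)) (fun x => (x : ι)))
      (fun x => a x) (fun x => b x) := by
    refine Sp.one _ _ _ ?_
    rintro ⟨x, rfl⟩
    exact h
  have ha : ∀ a : ι → F, a ∘ (Equiv.sumCompl (fun x => x = i)) =
      Sum.elim (fun x : {x // x = i} => a x) (fun x : {x // ¬ x = i} => a x) := by
    intro a
    ext x
    cases x <;> rfl
  rw [ha, ha]
  exact Sp.block h1 h' _ _

/-- conjugation by a transvection -/
def conjT {F ι : Type*} [Field F] [Fintype ι] [DecidableEq ι] (i j : ι) (c : F)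
    (M : Matrix ι ι F) : Matrix ι ι F :=
  Matrix.transvection i j c * M * Matrix.transvection i j (-c)

lemma conjT_apply {F ι : Type*} [Field F] [Fintype ι] [DecidableEq ι] (i j : ι) (c : F)
    (M : Matrix ι ι F) (x y : ι) : conjT i j c M x y =
      M x y + (if x = i then c * M j y else 0) -
        (if y = j then c * (M x i + if x = i then c * M j i else 0) else 0) := by
  have h : ∀ y, (Matrix.transvection i j c * M) x y = M x y + (if x = i then c * M j y else 0) := by
    intro y
    by_cases hx : x = i
    · subst hx; simp
    · simp [hx]
  unfold conjT
  by_cases hy : y = j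
  · subst hy
    rw [Matrix.mul_transvection_apply_same, h, h]
    simp
    ring
  · rw [Matrix.mul_transvection_apply_of_ne _ _ _ _ hy, h]
    simp [hy]

lemma Sp.conjT {F ι : Type*} [Field F] [Fintype ι] [DecidableEq ι] {M : Matrix ι ι F}
    {a b : ι → F} {i j : ι} (hij : i ≠ j) (c : F) (h : Sp (conjT i j c M) a b) : Sp M a b := by
  refine Sp.conj ?_ h
  rw [Matrix.transvection_mul_transvection_same _ _ hij]
  simp

lemma trace_conjT {F ι : Type*} [Field F] [Fintype ι] [DecidableEq ι] {M : Matrix ι ι F}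
    {i j : ι} (hij : i ≠ j) (c : F) : (conjT i j c M).trace = M.trace := by
  rw [SumPow.conjT, Matrix.trace_mul_comm, ← mul_assoc,
    Matrix.transvection_mul_transvection_same _ _ hij]
  simp

/-- `M` is not a scalar matrix. -/
def Nonscal {F ι : Type*} [Field F] (M : Matrix ι ι F) : Prop :=
  ∃ i j, i ≠ j ∧ (M i j ≠ 0 ∨ M i i ≠ M j j)

lemma Sp.main {F : Type*} [Field F] (n : ℕ) : ∀ {ι : Type} [Fintype ι] [DecidableEq ι]
    (M : Matrix ι ι F) (a b : ι → F), Fintype.card ι = n + 1 → (n = 0 ∨ Nonscal M) →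
    M.trace = ∑ i, (a i + b i) → Sp M a b := by
  induction n with
  | zero =>
    intro ι _ _ M a b hc _ ht
    have : Subsingleton ι := Fintype.card_le_one_iff_subsingleton.mp (by lia)
    refine Sp.one _ _ _ fun i => ?_
    have : Unique ι := uniqueOfSubsingleton i
    simpa [Matrix.trace, Subsingleton.elim default i] using ht
  | succ n ih =>
    intro ι _ _ M a b hc hns ht
    have hns : Nonscal M := by simpa using hns
    -- the final step
    have final : ∀ (M : Matrix ι ι F) (i j : ι), i ≠ j → M.trace = ∑ i, (a i + b i) →
        M i i = a i + b i → (n = 0 ∨ ∃ l, l ≠ i ∧ l ≠ j ∧ M l j ≠ 0) → Sp M a b := by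
      intro M i j hij ht hii hl
      refine Sp.remove M a b i hii (ih _ _ _ ?_ ?_ ?_)
      · rw [Fintype.card_subtype_compl, hc]
        simp
      · refine hl.imp_right ?_
        rintro ⟨l, hli, hlj, h⟩
        exact ⟨⟨l, hli⟩, ⟨j, hij.symm⟩, by simpa using hlj, Or.inl h⟩
      · have key : ∀ g : ι → F, ∑ x : {x // ¬ x = i}, g x = ∑ x, g x - g i := by
          intro g
          rw [← Finset.sum_subtype (univ.erase i) (p := fun x => ¬ x = i) (by simp) g,
            ← Finset.add_sum_erase _ _ (mem_univ i)]
          ring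
        have h1 := key (fun x => M x x)
        have h2 := key (fun x => a x + b x)
        simp only [Matrix.trace, Matrix.diag_apply] at ht
        simp only [Matrix.trace, Matrix.diag_apply, Matrix.submatrix_apply]
        rw [h1, h2, ht, hii]
    have stepC : ∀ (M : Matrix ι ι F) (i j : ι), i ≠ j → M.trace = ∑ i, (a i + b i) →
        M i i = a i + b i → M i j ≠ 0 → Sp M a b := by
      intro M i j hij ht hii hMij
      by_cases hn : n = 0
      · exact final M i j hij ht hii (Or.inl hn)
      obtain ⟨l, hli, hlj⟩ : ∃ l, l ≠ i ∧ l ≠ j := by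
        by_contra hcon
        push Not at hcon
        have : (univ : Finset ι) ⊆ {i, j} := by
          intro l _
          by_cases h : l = i
          · simp [h]
          · simp [hcon l h]
        have := (card_le_card this).trans card_le_two
        rw [card_univ] at this
        lia
      refine Sp.conjT (i := j) (j := l) hlj.symm (M i l / M i j) ?_
      set N := SumPow.conjT j l (M i l / M i j) M with hN
      have n1 : N i l = 0 := by
        rw [hN, conjT_apply]
        simp [hij]
        field_simp
        simp
      have n2 : N i i = M i i := by
        rw [hN, conjT_apply]
        simp [hij, hli.symm]
      have n3 : N i j = M i j := by
        rw [hN, conjT_apply]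
        simp [hij, hlj.symm]
      have n4 : N.trace = M.trace := trace_conjT hlj.symm _
      classical
      refine Sp.conjT (i := l) (j := i) hli (if N l j = 0 then 1 else 0) ?_
      refine final _ i j hij ?_ ?_ (Or.inr ⟨l, hli, hlj, ?_⟩)
      · rw [trace_conjT hli, n4, ht]
      · rw [conjT_apply]
        simp [hli.symm, n1, n2, hii]
      · rw [conjT_apply]
        by_cases h : N l j = 0
        · simp [h, hij.symm, n3, hMij]
        · simp [h]
    have stepB : ∀ (M : Matrix ι ι F) (i j : ι), i ≠ j → M.trace = ∑ i, (a i + b i) →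
        M i j ≠ 0 → Sp M a b := by
      intro M i j hij ht hMij
      refine Sp.conjT (i := j) (j := i) hij.symm ((M i i - (a i + b i)) / M i j) ?_
      refine stepC _ i j hij ?_ ?_ ?_
      · rw [trace_conjT hij.symm, ht]
      · rw [conjT_apply]
        simp [hij]
        field_simp
        ring
      · rw [conjT_apply]
        simpa [hij, hij.symm] using hMij
    by_cases hoff : ∃ i j, i ≠ j ∧ M i j ≠ 0
    · obtain ⟨i, j, hij, h⟩ := hoff
      exact stepB M i j hij ht h
    · push Not at hoff
      obtain ⟨i, j, hij, h⟩ := hns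
      have h : M i i ≠ M j j := by simpa [hoff i j hij] using h
      refine Sp.conjT hij 1 (stepB _ i j hij ?_ ?_)
      · rw [trace_conjT hij, ht]
      · rw [conjT_apply]
        simp [hoff i j hij, hoff j i hij.symm]
        exact fun h' => h (sub_eq_zero.mp h').symm

end
end SumPow

/-- The non-scalar case. -/
lemma SumPow.nonscalar_case {F : Type*} [Field F] [Fintype F] {k m : ℕ} (hk : (k : F) ≠ 0)
    (hq : ((SumPow.rt F k : ℝ) - 1) ^ 3 + 1 ≤ Fintype.card F) (hq3 : 3 ≤ Fintype.card F)
    (M : Matrix (Fin (m + 2)) (Fin (m + 2)) F) (hM : SumPow.Nonscal M) :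
    ∃ A B : Matrix (Fin (m + 2)) (Fin (m + 2)) F, M = A ^ k + B ^ k := by
  have hk1 : 1 ≤ k := by
    rcases Nat.eq_zero_or_pos k with rfl | h
    · simp at hk
    · exact h
  obtain ⟨x₀, x₁, y₀, y₁, hx, hy, h⟩ :=
    SumPow.four hk1 hq hq3 (M.trace - ∑ _i : Fin m, ((1 : F) + 1))
  let α : Fin (m + 2) → F := Fin.cons x₀ (Fin.cons x₁ (fun _ => 1))
  let β : Fin (m + 2) → F := Fin.cons y₀ (Fin.cons y₁ (fun _ => 1))
  have hα : ∀ i, i ≠ 1 → α i ≠ 0 := by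
    intro i
    refine Fin.cases ?_ (fun i => ?_) i
    · intro _; simpa [α] using hx
    · refine Fin.cases ?_ (fun i => ?_) i
      · intro h; exact absurd rfl h
      · intro _; simp [α]
  have hβ : ∀ i, i ≠ 1 → β i ≠ 0 := by
    intro i
    refine Fin.cases ?_ (fun i => ?_) i
    · intro _; simpa [β] using hy
    · refine Fin.cases ?_ (fun i => ?_) i
      · intro h; exact absurd rfl h
      · intro _; simp [β]
  have ht : M.trace = ∑ i, (α i ^ k + β i ^ k) := by
    rw [Fin.sum_univ_succ, Fin.sum_univ_succ]
    simp only [α, β, Fin.cons_zero, Fin.cons_succ, one_pow]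
    linear_combination -h
  obtain ⟨L, U, hLU, hL, hU⟩ := SumPow.Sp.main (m + 1) M (fun i => α i ^ k) (fun i => β i ^ k)
    (by simp) (Or.inr hM) ht
  obtain ⟨A, hA⟩ := SumPow.matroot hk α 1 hα L hL
  obtain ⟨B, hB⟩ := SumPow.matroot hk β 1 hβ U hU
  exact ⟨A, B, by rw [hA, hB, hLU]⟩

/-- The scalar case. -/
lemma SumPow.scalar_case (p : ℕ) (hp : p.Prime) {F : Type*} [Field F] [Fintype F] [CharP F p]
    {k n : ℕ} (hk : 1 ≤ k) (hn : 2 ≤ n)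
    (hq : ((k : ℝ) - 1) ^ 3 + 1 ≤ Fintype.card F) (c : F) :
    ∃ A B : Matrix (Fin n) (Fin n) F, algebraMap F _ c = A ^ k + B ^ k := by
  classical
  haveI : Fact p.Prime := ⟨hp⟩
  haveI : NeZero n := ⟨by lia⟩
  let E := FiniteField.Extension F p n
  haveI : Fintype E := Fintype.ofFinite E
  have hcard : Fintype.card E = Fintype.card F ^ n := by
    have := FiniteField.natCard_extension F p n
    rwa [Nat.card_eq_fintype_card, Nat.card_eq_fintype_card] at this
  have hfr : Module.finrank F E = n := by
    have h1 := Module.card_eq_pow_finrank (K := F) (V := E)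
    rw [hcard] at h1
    exact (Nat.pow_right_injective Fintype.one_lt_card h1).symm
  have hr1 : (1 : ℝ) ≤ SumPow.rt E k := by exact_mod_cast SumPow.rt_pos E k
  have hrk : (SumPow.rt E k : ℝ) ≤ k := by exact_mod_cast SumPow.rt_le E hk
  have hE : (((SumPow.rt E k : ℝ) - 1) ^ 3 + 1) ^ 2 ≤ Fintype.card E := by
    have h0 : 0 ≤ (SumPow.rt E k : ℝ) - 1 := by linarith
    have h1 : ((SumPow.rt E k : ℝ) - 1) ^ 3 + 1 ≤ Fintype.card F := by
      have : ((SumPow.rt E k : ℝ) - 1) ^ 3 ≤ ((k : ℝ) - 1) ^ 3 :=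
        pow_le_pow_left₀ h0 (by linarith) 3
      linarith
    rw [hcard, Nat.cast_pow]
    refine (pow_le_pow_left₀ (by positivity) h1 2).trans ?_
    exact pow_le_pow_right₀ (by exact_mod_cast Fintype.card_pos) hn
  obtain ⟨x, y, hxy⟩ := SumPow.two hk hE (algebraMap F E c)
  let b : Module.Basis (Fin n) F E := Module.finBasisOfFinrankEq F E hfr
  refine ⟨Algebra.leftMulMatrix b x, Algebra.leftMulMatrix b y, ?_⟩
  rw [← map_pow, ← map_pow, ← map_add, hxy, AlgHom.commutes]

theorem stmt11 (p : ℕ) (hp : p.Prime) (F : Type*) [Field F] [Fintype F] [CharP F p]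
    (k n : ℕ) (hk : 1 ≤ k) (hn : 2 ≤ n) (hpk : ¬ p ∣ k)
    (hq : (Fintype.card F : ℤ) ≥ (k : ℤ) ^ 3 - 3 * (k : ℤ) ^ 2 + 3 * (k : ℤ)) :
    ∀ M : Matrix (Fin n) (Fin n) F, ∃ A B : Matrix (Fin n) (Fin n) F,
      M = A ^ k + B ^ k := by
  intro M
  have hqr : ((k : ℝ) - 1) ^ 3 + 1 ≤ Fintype.card F := by
    have h : ((k : ℤ) - 1) ^ 3 + 1 ≤ Fintype.card F := by linarith
    exact_mod_cast h
  rcases Nat.eq_or_lt_of_le hk with rfl | hk2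
  · exact ⟨M, 0, by simp⟩
  have hkF : (k : F) ≠ 0 := by
    rwa [Ne, CharP.cast_eq_zero_iff F p]
  by_cases hM : SumPow.Nonscal M
  · obtain ⟨m, rfl⟩ : ∃ m, n = m + 2 := ⟨n - 2, by lia⟩
    have hr1 : (1 : ℝ) ≤ SumPow.rt F k := by exact_mod_cast SumPow.rt_pos F k
    have hrk : (SumPow.rt F k : ℝ) ≤ k := by exact_mod_cast SumPow.rt_le F hk
    have h3 : ((SumPow.rt F k : ℝ) - 1) ^ 3 ≤ ((k : ℝ) - 1) ^ 3 :=
      pow_le_pow_left₀ (by linarith) (by linarith) 3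
    have hq3 : 3 ≤ Fintype.card F := by
      by_contra hlt
      have h2 : Fintype.card F = 2 := by
        have : 1 < Fintype.card F := Fintype.one_lt_card
        lia
      have hp2 : p = 2 := by
        have h0 : (2 : F) = 0 := by
          have := Nat.cast_card_eq_zero F
          rw [h2] at this
          exact_mod_cast this
        have : p ∣ 2 := (CharP.cast_eq_zero_iff F p 2).mp (by exact_mod_cast h0)
        exact (Nat.prime_dvd_prime_iff_eq hp Nat.prime_two).mp this
      have hk3 : (3 : ℝ) ≤ k := by
        have : 3 ≤ k := by
          subst hp2
          lia
        exact_mod_cast this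
      have : (2 : ℝ) ^ 3 ≤ ((k : ℝ) - 1) ^ 3 := pow_le_pow_left₀ (by norm_num) (by linarith) 3
      rw [h2] at hqr
      norm_num at hqr this
      linarith
    exact SumPow.nonscalar_case hkF (by linarith) hq3 M hM
  · have hMs : M = algebraMap F _ (M ⟨0, by lia⟩ ⟨0, by lia⟩) := by
      ext i j
      rw [Matrix.algebraMap_matrix_apply]
      unfold SumPow.Nonscal at hM
      push Not at hM
      split_ifs with h
      · subst h
        by_cases h0 : i = ⟨0, by lia⟩
        · rw [← h0]; rfl
        · exact (hM _ _ h0).2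
      · exact (hM _ _ h).1
    rw [hMs]
    exact SumPow.scalar_case p hp hk hn hqr _
end

section
/- Let q = p^l and d := gcd(k, q−1), and suppose d ≠ q−1 and every element of 𝔽_q is a sum of d elements of 𝔽_q each of which is a d-th power. If either (q−1 ≠ d(l+1) and n > l(p−1)) or n > (l+1)(p−1), then every cyclic matrix in M_n(𝔽_q) can be written as A^k + B^k with A, B ∈ M_n(𝔽_q). -/
/-- A matrix `A` is cyclic if there is a vector `v` such that
`v, A v, …, A^(n-1) v` span (equivalently, form a basis of) `F^n`. -/
def IsCyclicMatrix {n : ℕ} {F : Type*} [Field F]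
    (A : Matrix (Fin n) (Fin n) F) : Prop :=
  ∃ v : Fin n → F,
    Submodule.span F (Set.range fun i : Fin n => (A ^ (i : ℕ)).mulVec v) = ⊤


/-- `s` is an allowed sum for slot `m` -/
def SlotOK {F : Type*} [Field F] (P : Set F) (m : ℕ) (s : F) : Prop :=
  ∃ u w, u ∈ P ∧ w ∈ P ∧ u ≠ w ∧ (¬ Even m → u ≠ 1 ∧ w ≠ 1) ∧ s = u + w

lemma aux_slots {F : Type*} [Field F] (P : Set F) (h0 : (0 : F) ∈ P) (h1 : (1 : F) ∈ P)
    (N : ℕ) (T : F) (s : ℕ → F) (hs : ∀ m < N, SlotOK P m (s m))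
    (hT : T = 1 + ∑ m ∈ Finset.range N, s m) :
    ∃ α β : ℕ → F, (∀ j ≤ N, α j ∈ P) ∧ (∀ j ≤ N, β j ∈ P) ∧ β 0 = 1 ∧
      (∀ j < N, α j ≠ β (j + 1)) ∧ (∀ j ≤ N, ¬ Even j → α j ≠ 1) ∧
      (∀ j ≤ N, Even j → 0 < j → β j ≠ 1) ∧
      T = ∑ j ∈ Finset.range (N + 1), (α j + β j) := by
  choose! u w hu hw huw hodd hsum using hs
  refine ⟨fun j => if j < N then u j else 0, fun j => Nat.casesOn j 1 w, ?_, ?_, rfl, ?_, ?_, ?_, ?_⟩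
  · intro j hj
    by_cases h : j < N <;> simp [h, h0, hu]
  · intro j hj
    rcases j with _ | j
    · exact h1
    · exact hw j (by omega)
  · intro j hj
    simpa [hj] using huw j hj
  · intro j hj he
    by_cases h : j < N
    · simpa [h] using (hodd j h he).1
    · simp [h]
  · intro j hj he hpos
    rcases j with _ | j
    · omega
    · exact (hodd j (by omega) (by simpa [Nat.even_add_one] using he)).2
  · rw [Finset.sum_add_distrib, Finset.sum_range_succ, Finset.sum_range_succ' (fun j => Nat.casesOn (motive := fun _ => F) j 1 w), hT]
    have : ∑ m ∈ Finset.range N, s m = ∑ m ∈ Finset.range N, (if m < N then u m else 0)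
      + ∑ m ∈ Finset.range N, w m := by
      rw [← Finset.sum_add_distrib]
      apply Finset.sum_congr rfl
      intro m hm
      have := Finset.mem_range.1 hm
      simp [this, hsum m this]
    rw [this]
    simp
    ring

lemma aux_multiset {F : Type*} [Field F] (m : Multiset F) :
    ∃ s : ℕ → F, (∀ i < m.card, s i ∈ m) ∧ ∑ i ∈ Finset.range m.card, s i = m.sum := by
  induction m using Multiset.induction_on with
  | empty => exact ⟨fun _ => 0, by simp, by simp⟩
  | cons a m ih =>
    obtain ⟨s, h1, h2⟩ := ih
    refine ⟨fun i => if i < m.card then s i else a, ?_, ?_⟩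
    · intro i hi
      by_cases h : i < m.card
      · simp [h, h1 i h]
      · simp [h]
    · rw [Multiset.card_cons, Finset.sum_range_succ, Multiset.sum_cons, ← h2, add_comm]
      simp only [lt_irrefl, if_false]
      congr 1
      apply Finset.sum_congr rfl
      intro i hi
      simp [Finset.mem_range.1 hi]

lemma aux_add {F : Type*} [Field F] [Fintype F] (p l : ℕ) [Fact p.Prime] [Algebra (ZMod p) F]
    (hcard : Fintype.card F = p ^ l) (S : Set F) (s0 : F) (hs0 : s0 ∈ S)
    (hspan : ⊤ ≤ Submodule.span (ZMod p) ((fun s => s - s0) '' S)) (N : ℕ) (hN : l * (p - 1) ≤ N)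
    (T : F) : ∃ s : ℕ → F, (∀ i < N, s i ∈ S) ∧ ∑ i ∈ Finset.range N, s i = T := by
  classical
  have hfr : Module.finrank (ZMod p) F = l := by
    have h := Module.card_eq_pow_finrank (K := ZMod p) (V := F)
    rw [hcard, ZMod.card] at h
    exact (Nat.pow_right_injective (Fact.out : p.Prime).two_le h).symm
  let b := Module.Basis.ofSpan hspan
  have hb : ∀ i, b i ∈ (fun s => s - s0) '' S := fun i => Module.Basis.ofSpan_subset hspan ⟨i, rfl⟩
  have : Fintype _ := FiniteDimensional.fintypeBasisIndex b
  choose g hg hgs using hb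
  let r := b.repr (T - N • s0)
  let c := fun i => (r i).val
  have hc : ∑ i, c i ≤ N := by
    refine le_trans (Finset.sum_le_card_nsmul _ _ (p - 1) ?_) ?_
    · intro i _
      have := ZMod.val_lt (r i)
      simp only [c]; omega
    · rw [Finset.card_univ, ← Module.finrank_eq_card_basis b, hfr]; simpa using hN
  let m : Multiset F := ∑ i, Multiset.replicate (c i) (g i) + Multiset.replicate (N - ∑ i, c i) s0
  have hm : m.card = N := by
    simp only [m, Multiset.card_add, Multiset.card_replicate, Multiset.card_sum]
    omega
  have hsum : m.sum = T := by
    have h1 : T - N • s0 = ∑ i, c i • (g i - s0) := by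
      rw [← b.sum_repr (T - N • s0)]
      apply Finset.sum_congr rfl
      intro i _
      have : g i - s0 = b i := hgs i
      rw [this, ← Nat.cast_smul_eq_nsmul (ZMod p) (c i)]
      simp only [c, r, ZMod.natCast_zmod_val]
    have h2 : m.sum = ∑ i, c i • g i + (N - ∑ i, c i) • s0 := by
      simp [m, Multiset.sum_sum, Multiset.sum_replicate]
    rw [h2, sub_eq_iff_eq_add.1 h1]
    have : N • s0 = (∑ i, c i) • s0 + (N - ∑ i, c i) • s0 := by
      rw [← add_smul]; congr 1; omega
    rw [this, Finset.sum_smul]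
    simp only [smul_sub, Finset.sum_sub_distrib]
    abel
  obtain ⟨s, h1, h2⟩ := aux_multiset m
  rw [hm] at h1 h2
  refine ⟨s, fun i hi => ?_, h2.trans hsum⟩
  have := h1 i hi
  simp only [m, Multiset.mem_add, Multiset.mem_sum, Multiset.mem_replicate] at this
  rcases this with ⟨j, _, hj⟩ | hj
  · rw [hj.2]; exact hg j
  · rw [hj.2]; exact hs0

lemma aux_caseB {F : Type*} [Field F] (P : Set F) (h0 : (0 : F) ∈ P) (h1 : (1 : F) ∈ P)
    (hm1 : (-1 : F) ∈ P) (hne : (-1 : F) ≠ 1) (N : ℕ) :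
    ∀ c ≤ 2 * ((N + 1) / 2), ∃ s : ℕ → F, (∀ i < N, SlotOK P i (s i)) ∧
      ∑ i ∈ Finset.range N, s i = -(N : F) + c := by
  have ext : ∀ (N c : ℕ) (s : ℕ → F) (z : F), (∀ i < N, SlotOK P i (s i)) →
      ∑ i ∈ Finset.range N, s i = -(N : F) + c → SlotOK P N z →
      ∃ s' : ℕ → F, (∀ i < N + 1, SlotOK P i (s' i)) ∧
      ∑ i ∈ Finset.range (N + 1), s' i = -(N : F) + c + z := by
    intro N c s z h1 h2 h3
    refine ⟨fun i => if i < N then s i else z, ?_, ?_⟩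
    · intro i hi
      by_cases h : i < N
      · simpa [h] using h1 i h
      · have : i = N := by omega
        subst this; simpa using h3
    · rw [Finset.sum_range_succ, ← h2]
      congr 1
      · apply Finset.sum_congr rfl
        intro i hi
        simp [Finset.mem_range.1 hi]
      · simp
  have ok1 : ∀ m, SlotOK P m (-1 : F) := fun m =>
    ⟨0, -1, h0, hm1, by simp, fun _ => ⟨by simp, hne⟩, by simp⟩
  induction N with
  | zero =>
    intro c hc
    have hc0 : c = 0 := by omega
    exact ⟨fun _ => 0, by simp, by simp [hc0]⟩
  | succ N ih =>
    intro c hc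
    by_cases hN : Even N
    · obtain ⟨N', rfl⟩ := hN
      by_cases hc2 : c ≤ 2 * ((N' + N' + 1) / 2)
      · obtain ⟨s, a1, a2⟩ := ih c hc2
        obtain ⟨s', b1, b2⟩ := ext _ c s _ a1 a2 (ok1 _)
        exact ⟨s', b1, by rw [b2]; push_cast; ring⟩
      · obtain ⟨s, a1, a2⟩ := ih (2 * N') (by omega)
        have : c = 2 * N' + 1 ∨ c = 2 * N' + 2 := by omega
        rcases this with rfl | rfl
        · obtain ⟨s', b1, b2⟩ := ext _ _ s 0 a1 a2
            ⟨1, -1, h1, hm1, hne.symm, fun h => absurd ⟨N', rfl⟩ h, by simp⟩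
          exact ⟨s', b1, by rw [b2]; push_cast; ring⟩
        · obtain ⟨s', b1, b2⟩ := ext _ _ s 1 a1 a2
            ⟨1, 0, h1, h0, by simp, fun h => absurd ⟨N', rfl⟩ h, by simp⟩
          exact ⟨s', b1, by rw [b2]; push_cast; ring⟩
    · rw [Nat.not_even_iff_odd] at hN
      obtain ⟨N', rfl⟩ := hN
      obtain ⟨s, a1, a2⟩ := ih c (by omega)
      obtain ⟨s', b1, b2⟩ := ext _ c s _ a1 a2 (ok1 _)
      exact ⟨s', b1, by rw [b2]; push_cast; ring⟩

/-- `d`-th powers are `k`-th powers -/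
lemma aux_gcd {F : Type*} [Field F] [Fintype F] (k : ℕ) (hk : 1 ≤ k) (x : F) :
    ∃ y : F, y ^ k = x ^ (Nat.gcd k (Fintype.card F - 1)) := by
  have hg : 0 < Nat.gcd k (Fintype.card F - 1) := Nat.gcd_pos_of_pos_left _ hk
  by_cases hx : x = 0
  · exact ⟨0, by rw [hx, zero_pow (by omega), zero_pow (by omega)]⟩
  · refine ⟨x ^ (Nat.gcdA k (Fintype.card F - 1)), ?_⟩
    have h := Nat.gcd_eq_gcd_ab k (Fintype.card F - 1)
    rw [← zpow_natCast x (Nat.gcd _ _), h, zpow_add₀ hx, zpow_mul x _ (Nat.gcdB _ _),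
      zpow_natCast x (Fintype.card F - 1), FiniteField.pow_card_sub_one_eq_one x hx, one_zpow, mul_one, mul_comm,
      zpow_mul, zpow_natCast]

lemma aux_comb {F : Type*} [Field F] [Fintype F] (p l : ℕ) (hp : p.Prime) (hl : 1 ≤ l) [CharP F p]
    (hcard : Fintype.card F = p ^ l) (k N : ℕ) (hk : 1 ≤ k)
    (d : ℕ) (hd : d = Nat.gcd k (Fintype.card F - 1))
    (hdq : d ≠ Fintype.card F - 1)
    (hW : ∀ x : F, ∃ f : Fin d → F, x = ∑ i, (f i) ^ d) (hN : l * (p - 1) ≤ N) (T : F) :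
    ∃ s : ℕ → F, (∀ m < N, SlotOK (Set.range fun x : F => x ^ k) m (s m)) ∧
      T = 1 + ∑ m ∈ Finset.range N, s m := by
  classical
  haveI : Fact p.Prime := ⟨hp⟩
  letI : Algebra (ZMod p) F := ZMod.algebra F p
  set P : Set F := Set.range fun x : F => x ^ k with hPdef
  have h0 : (0 : F) ∈ P := ⟨0, by simp; omega⟩
  have h1 : (1 : F) ∈ P := ⟨1, by simp⟩
  have hmul : ∀ a ∈ P, ∀ b ∈ P, a * b ∈ P := by
    rintro _ ⟨a, rfl⟩ _ ⟨b, rfl⟩; exact ⟨a * b, by simp [mul_pow]⟩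
  have hinv : ∀ a ∈ P, a⁻¹ ∈ P := by
    rintro _ ⟨a, rfl⟩; exact ⟨a⁻¹, by simp⟩
  have hdP : ∀ x : F, x ^ d ∈ P := by
    intro x; rw [hd]; exact aux_gcd k hk x
  have hgen : ∀ W : Submodule (ZMod p) F, (∀ a ∈ P, a ∈ W) → ⊤ ≤ W := by
    intro W hPW x _
    obtain ⟨f, hf⟩ := hW x
    rw [hf]
    exact Submodule.sum_mem _ (fun i _ => hPW _ (hdP _))
  obtain ⟨a, haP, ha0, ha1⟩ : ∃ a ∈ P, a ≠ 0 ∧ a ≠ 1 := by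
    by_contra! hcon
    apply hdq
    rw [hd]
    apply Nat.gcd_eq_right
    rw [← FiniteField.forall_pow_eq_one_iff]
    intro x
    have := hcon ((x : F) ^ k) ⟨x, rfl⟩ (by simp)
    ext; simpa using this
  by_cases hA : ∃ b ∈ P, b ≠ 0 ∧ b ≠ 1 ∧ b ≠ a
  · obtain ⟨b, hbP, hb0, hb1, hba⟩ := hA
    let S : Set F := {s | ∃ u w, u ∈ P ∧ w ∈ P ∧ u ≠ w ∧ u ≠ 1 ∧ w ≠ 1 ∧ s = u + w}
    have hPS : ∀ h ∈ P, h ≠ 0 → h ≠ 1 → h ∈ S := fun h hP hh0 hh1 =>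
      ⟨0, h, h0, hP, hh0.symm, by simp, hh1, by simp⟩
    have hspan : ⊤ ≤ Submodule.span (ZMod p) ((fun s => s - a) '' S) := by
      apply hgen
      set W := Submodule.span (ZMod p) ((fun s => s - a) '' S) with hWdef
      have hSW : ∀ s ∈ S, s - a ∈ W := fun s hs => Submodule.subset_span ⟨s, hs, rfl⟩
      have hA1 : ∀ h ∈ P, h ≠ 0 → h ≠ 1 → h ∈ W := by
        intro h hP hh0 hh1
        obtain ⟨h', hP', hh0', hh1', hne⟩ : ∃ h' ∈ P, h' ≠ 0 ∧ h' ≠ 1 ∧ h ≠ h' := by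
          by_cases hha : h = a
          · exact ⟨b, hbP, hb0, hb1, by rw [hha]; exact hba.symm⟩
          · exact ⟨a, haP, ha0, ha1, hha⟩
        have e1 := hSW (h + h') ⟨h, h', hP, hP', hne, hh1, hh1', rfl⟩
        have e2 := hSW h' (hPS h' hP' hh0' hh1')
        have := sub_mem e1 e2
        have e3 : h + h' - a - (h' - a) = h := by ring
        rwa [e3] at this
      have h1W : (1 : F) ∈ W := by
        let H : Finset F := Finset.univ.filter (fun y => y ∈ P ∧ y ≠ 0)
        have hsum : ∑ y ∈ H, y = 0 := by
          have e : ∑ y ∈ H, y = ∑ y ∈ H, a * y := by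
            symm
            refine Finset.sum_bij' (fun y _ => a * y) (fun y _ => a⁻¹ * y) ?_ ?_ ?_ ?_ ?_
            · intro y hy
              simp only [H, Finset.mem_filter, Finset.mem_univ, true_and] at hy ⊢
              exact ⟨hmul _ haP _ hy.1, mul_ne_zero ha0 hy.2⟩
            · intro y hy
              simp only [H, Finset.mem_filter, Finset.mem_univ, true_and] at hy ⊢
              exact ⟨hmul _ (hinv _ haP) _ hy.1, mul_ne_zero (inv_ne_zero ha0) hy.2⟩
            · intro y _; simp [ha0]
            · intro y _; simp [ha0]
            · intro y _; rfl
          rw [← Finset.mul_sum] at e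
          have : (a - 1) * ∑ y ∈ H, y = 0 := by linear_combination -e
          exact (mul_eq_zero.1 this).resolve_left (sub_ne_zero.2 ha1)
        have h1H : (1 : F) ∈ H := by simp [H, h1]
        rw [← Finset.add_sum_erase _ _ h1H] at hsum
        rw [eq_neg_of_add_eq_zero_left hsum]
        refine neg_mem (Submodule.sum_mem _ ?_)
        intro y hy
        simp only [H, Finset.mem_erase, Finset.mem_filter, Finset.mem_univ, true_and] at hy
        exact hA1 y hy.2.1 hy.2.2 hy.1
      intro h hP
      by_cases hh0 : h = 0
      · rw [hh0]; exact zero_mem _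
      by_cases hh1 : h = 1
      · rw [hh1]; exact h1W
      exact hA1 h hP hh0 hh1
    obtain ⟨s, hs1, hs2⟩ := aux_add p l hcard S a (hPS a haP ha0 ha1) hspan N hN (T - 1)
    refine ⟨s, fun m hm => ?_, by rw [hs2]; ring⟩
    obtain ⟨u, w, hu, hw, huw, hu1, hw1, hs⟩ := hs1 m hm
    exact ⟨u, w, hu, hw, huw, fun _ => ⟨hu1, hw1⟩, hs⟩
  · push Not at hA
    have haa : a = -1 := by
      have h2 : a * a = 1 := by
        by_contra h
        have := hA (a * a) (hmul _ haP _ haP) (mul_ne_zero ha0 ha0) h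
        exact ha1 (mul_left_cancel₀ ha0 (by rw [this, mul_one]))
      exact (mul_self_eq_one_iff.1 h2).resolve_left ha1
    subst haa
    have htop : ⊤ ≤ Submodule.span (ZMod p) ({1} : Set F) := by
      apply hgen
      have hone : (1 : F) ∈ Submodule.span (ZMod p) ({1} : Set F) :=
        Submodule.subset_span rfl
      intro h hP
      by_cases hh0 : h = 0
      · rw [hh0]; exact zero_mem _
      by_cases hh1 : h = 1
      · rw [hh1]; exact hone
      rw [hA h hP hh0 hh1]
      exact neg_mem hone
    obtain ⟨z, hz⟩ := Submodule.mem_span_singleton.1 (htop (Submodule.mem_top (x := T - 1 + N)))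
    have hzv := ZMod.val_lt z
    have hz' : ((z.val : ℕ) : F) = T - 1 + N := by
      rw [← hz, Algebra.smul_def, mul_one]
      conv_rhs => rw [← ZMod.natCast_zmod_val z, map_natCast]
    have hpN : p - 1 ≤ N := le_trans (Nat.le_mul_of_pos_left _ hl) hN
    obtain ⟨s, hs1, hs2⟩ := aux_caseB P h0 h1 haP ha1 N z.val (by omega)
    refine ⟨s, hs1, ?_⟩
    rw [hs2, hz']; ring

section
open Polynomial
/-- annihilated by the product over `P` implies k-th power -/
lemma aux_pow {F V : Type*} [Field F] [AddCommGroup V] [Module F V] (k : ℕ) (Pf : Finset F)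
    (hP : ∀ a ∈ Pf, ∃ x : F, x ^ k = a) (X : Module.End F V)
    (hX : aeval X (∏ a ∈ Pf, (Polynomial.X - C a)) = 0) :
    ∃ A : Module.End F V, A ^ k = X := by
  classical
  choose! r hr using hP
  set R := Lagrange.interpolate Pf id r with hR
  have hdvd : (∏ a ∈ Pf, (Polynomial.X - C a)) ∣ R ^ k - Polynomial.X := by
    apply Finset.prod_dvd_of_coprime
    · intro a _ b _ hab
      exact pairwise_coprime_X_sub_C (fun _ _ h => h) hab
    · intro a ha
      rw [dvd_iff_isRoot]
      have : eval a R = r a := by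
        have := Lagrange.eval_interpolate_at_node (s := Pf) (v := id) r
          (Function.injective_id.injOn) ha
        exact this
      simp [this, hr a ha]
  obtain ⟨S, hS⟩ := hdvd
  refine ⟨aeval X R, ?_⟩
  have h2 : aeval X (R ^ k - Polynomial.X) = 0 := by rw [hS, map_mul, hX, zero_mul]
  rw [map_sub, map_pow, aeval_X] at h2
  exact sub_eq_zero.mp h2

/-- two-step annihilation -/
lemma aux_two {F V : Type*} [Field F] [AddCommGroup V] [Module F V] [DecidableEq F] (Pf : Finset F)
    (X : Module.End F V) (v w : V) (a b : F) (ha : a ∈ Pf) (e : F)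
    (he : e = 0 ∨ (b ∈ Pf ∧ a ≠ b))
    (h1 : X v = a • v + e • w) (h2 : e ≠ 0 → X w = b • w) :
    aeval X (∏ a ∈ Pf, (Polynomial.X - C a)) v = 0 := by
  rw [← Finset.prod_erase_mul _ _ ha, map_mul, Module.End.mul_apply]
  have : (aeval X (Polynomial.X - C a)) v = e • w := by
    simp [h1]
  rw [this]
  by_cases h0 : e = 0
  · simp [h0]
  · obtain ⟨hb, hab⟩ := he.resolve_left h0
    have hb' : b ∈ Pf.erase a := Finset.mem_erase.2 ⟨hab.symm, hb⟩
    rw [← Finset.prod_erase_mul _ _ hb', map_mul, Module.End.mul_apply]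
    simp [h2 h0]

lemma aux_last {F V : Type*} [Field F] [AddCommGroup V] [Module F V] [DecidableEq F] (Pf : Finset F)
    (X : Module.End F V) (v w : V) (a : F) (ha : a ∈ Pf)
    (h1 : X v = a • v + w) (h2 : aeval X (∏ a ∈ Pf.erase a, (Polynomial.X - C a)) w = 0) :
    aeval X (∏ a ∈ Pf, (Polynomial.X - C a)) v = 0 := by
  rw [← Finset.prod_erase_mul _ _ ha, map_mul, Module.End.mul_apply]
  have : (aeval X (Polynomial.X - C a)) v = w := by
    simp [h1]
  rw [this, h2]

/-- the linear algebra part, in a good basis -/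
lemma aux_basis {F V : Type*} [Field F] [AddCommGroup V] [Module F V] (k N : ℕ)
    (Pf : Finset F) (hP : ∀ a ∈ Pf, ∃ x : F, x ^ k = a)
    (M : Module.End F V) (c : Module.Basis (Fin (N + 1)) F V) (α β : ℕ → F)
    (hα : ∀ j ≤ N, α j ∈ Pf) (hβ : ∀ j ≤ N, β j ∈ Pf)
    (hβ0 : β 0 = 1) (hne : ∀ j < N, α j ≠ β (j + 1))
    (ho : ∀ j ≤ N, ¬ Even j → α j ≠ 1) (hev : ∀ j ≤ N, Even j → 0 < j → β j ≠ 1)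
    (hM : ∀ j (hj : j < N), M (c ⟨j + 1, by omega⟩) =
      (α (j + 1) + β (j + 1)) • c ⟨j + 1, by omega⟩ + c ⟨j, by omega⟩)
    (htr : LinearMap.trace F V M = ∑ j ∈ Finset.range (N + 1), (α j + β j)) :
    ∃ A B : Module.End F V, M = A ^ k + B ^ k := by
  classical
  -- the last coefficient
  have hc0 : c.repr (M (c 0)) 0 = α 0 + β 0 := by
    rw [LinearMap.trace_eq_matrix_trace F c, Matrix.trace, Fin.sum_univ_succ,
      Finset.sum_range_succ'] at htr
    have : ∀ i : Fin N, Matrix.diag (LinearMap.toMatrix c c M) i.succ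
        = α (i + 1) + β (i + 1) := by
      intro i
      have h := hM i i.2
      rw [Matrix.diag_apply, LinearMap.toMatrix_apply]
      have e1 : (⟨i + 1, by omega⟩ : Fin (N + 1)) = i.succ := rfl
      rw [e1] at h
      rw [h, map_add, map_smul, c.repr_self, c.repr_self]
      have e2 : (⟨(i : ℕ), by omega⟩ : Fin (N + 1)) ≠ i.succ := by
        intro h; have := congrArg Fin.val h; simp at this
      simp [Finsupp.single_apply, e2]
    rw [Finset.sum_congr rfl (fun i _ => this i),
      Fin.sum_univ_eq_sum_range (fun i => α (i + 1) + β (i + 1)) N, add_comm] at htr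
    have := add_left_cancel htr
    rw [Matrix.diag_apply, LinearMap.toMatrix_apply] at this
    exact this
  let x : ℕ → F := fun j => if Even j then α j else β j
  let y : ℕ → F := fun j => if Even j then β j else α j
  have hxy : ∀ j, α j + β j = x j + y j := by
    intro j; by_cases h : Even j <;> simp [x, y, h, add_comm]
  let e : ℕ → F := fun j => if Even j then 1 else 0
  let X : Module.End F V := c.constr F (fun j : Fin (N + 1) =>
    Fin.cases (x 0 • c 0) (fun i => x (i + 1) • c i.succ + e i • c i.castSucc) j)
  have hX0 : X (c 0) = x 0 • c 0 := by simp only [X, Module.Basis.constr_basis, Fin.cases_zero]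
  have hXs : ∀ i : Fin N, X (c i.succ) = x (i + 1) • c i.succ + e i • c i.castSucc := by
    intro i
    simp only [X, Module.Basis.constr_basis, Fin.cases_succ]
  have hMs : ∀ i : Fin N, M (c i.succ) = (x (i + 1) + y (i + 1)) • c i.succ + c i.castSucc := by
    intro i
    rw [← hxy]
    exact hM i i.2
  set Y : Module.End F V := M - X with hY
  have hYs : ∀ i : Fin N, Y (c i.succ) = y (i + 1) • c i.succ + (1 - e i) • c i.castSucc := by
    intro i
    rw [hY, LinearMap.sub_apply, hMs, hXs]
    module
  have hxP : ∀ j ≤ N, x j ∈ Pf := by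
    intro j hj; by_cases h : Even j <;> simp [x, h, hα, hβ, hj]
  have hyP : ∀ j ≤ N, y j ∈ Pf := by
    intro j hj; by_cases h : Even j <;> simp [y, h, hα, hβ, hj]
  have hy1 : ∀ j, 0 < j → j ≤ N → y j ≠ 1 := by
    intro j hj0 hj
    by_cases h : Even j
    · simpa [y, h] using hev j hj h hj0
    · simpa [y, h] using ho j hj h
  have hy0 : y 0 = 1 := by simp [y, hβ0]
  have hXk : aeval X (∏ a ∈ Pf, (Polynomial.X - C a)) = 0 := by
    apply c.ext
    intro j
    rw [LinearMap.zero_apply]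
    refine Fin.cases ?_ (fun i => ?_) j
    · exact aux_two Pf X (c 0) 0 (x 0) 0 (hxP 0 (by omega)) 0 (Or.inl rfl) (by simp [hX0]) (by simp)
    · refine aux_two Pf X _ _ (x (i + 1)) (x i) (hxP _ (by omega)) (e i) ?_ (hXs i) ?_
      · by_cases h : Even (i : ℕ)
        · right
          refine ⟨hxP _ (by omega), ?_⟩
          have : ¬ Even ((i : ℕ) + 1) := by simpa [Nat.even_add_one] using h
          simpa [x, h, this] using (hne i i.2).symm
        · left; simp [e, h]
      · intro he
        have h : Even (i : ℕ) := by by_contra h; simp [e, h] at he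
        rcases i with ⟨i, hi⟩
        rcases i with _ | i
        · exact hX0
        · have := hXs ⟨i, by omega⟩
          have h' : ¬ Even i := by simpa [Nat.even_add_one] using h
          simpa [e, h'] using this
  have hYk' : ∀ i : Fin N, aeval Y (∏ a ∈ Pf.erase 1, (Polynomial.X - C a)) (c i.succ) = 0 := by
    intro i
    refine aux_two (Pf.erase 1) Y _ (c i.castSucc) (y (i + 1)) (y i)
      (Finset.mem_erase.2 ⟨hy1 _ (by omega) (by omega), hyP _ (by omega)⟩) (1 - e i) ?_ (hYs i) ?_
    · by_cases h : Even (i : ℕ)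
      · left; simp [e, h]
      · right
        have hi : 0 < (i : ℕ) := by
          rcases Nat.eq_zero_or_pos (i : ℕ) with h0 | h0
          · rw [h0] at h; simp at h
          · exact h0
        refine ⟨Finset.mem_erase.2 ⟨hy1 _ hi (by omega), hyP _ (by omega)⟩, ?_⟩
        have : Even ((i : ℕ) + 1) := by simpa [Nat.even_add_one] using h
        simpa [y, h, this] using (hne i i.2).symm
    · intro he
      have h : ¬ Even (i : ℕ) := by intro h; simp [e, h] at he
      rcases i with ⟨i, hi⟩
      rcases i with _ | i
      · simp at h
      · have := hYs ⟨i, by omega⟩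
        have h' : Even i := by simpa [Nat.even_add_one] using h
        simpa [e, h'] using this
  have hYk : aeval Y (∏ a ∈ Pf, (Polynomial.X - C a)) = 0 := by
    have h1P : (1 : F) ∈ Pf := hβ0 ▸ hβ 0 (by omega)
    apply c.ext
    intro j
    rw [LinearMap.zero_apply]
    refine Fin.cases ?_ (fun i => ?_) j
    · refine aux_last Pf Y (c 0) (∑ i : Fin N, c.repr (M (c 0)) i.succ • c i.succ) 1 h1P ?_ ?_
      · have h := c.sum_repr (M (c 0))
        rw [Fin.sum_univ_succ, hc0, hxy, hy0] at h
        generalize (∑ i : Fin N, c.repr (M (c 0)) i.succ • c i.succ) = w at h ⊢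
        rw [hY, LinearMap.sub_apply, hX0, ← h]
        module
      · rw [map_sum]
        apply Finset.sum_eq_zero
        intro i _
        rw [map_smul, hYk', smul_zero]
    · rw [← Finset.mul_prod_erase _ _ h1P, map_mul, Module.End.mul_apply, hYk', map_zero]
  obtain ⟨A, hA⟩ := aux_pow k Pf hP X hXk
  obtain ⟨B, hB⟩ := aux_pow k Pf hP Y hYk
  exact ⟨A, B, by rw [hA, hB, hY]; abel⟩

/-- building the good basis of a cyclic endomorphism -/
lemma aux_cyc {F V : Type*} [Field F] [AddCommGroup V] [Module F V] (N : ℕ)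
    (hV : Module.finrank F V = N + 1)
    (M : Module.End F V) (v : V)
    (hv : Submodule.span F (Set.range fun i : Fin (N + 1) => (M ^ (i : ℕ)) v) = ⊤) (a : ℕ → F) :
    ∃ c : Module.Basis (Fin (N + 1)) F V, ∀ j (hj : j < N), M (c ⟨j + 1, by omega⟩) =
      a (j + 1) • c ⟨j + 1, by omega⟩ + c ⟨j, by omega⟩ := by
  let u : ℕ → V := fun i => Nat.rec v (fun i w => M w - a (N - i) • w) i
  have hu0 : u 0 = v := rfl
  have hus : ∀ i, M (u i) = u (i + 1) + a (N - i) • u i := by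
    intro i
    change M (u i) = (M (u i) - a (N - i) • u i) + _
    simp
  have key : ∀ i, (M ^ i) v ∈ Submodule.span F (u '' {j | j ≤ i}) := by
    intro i
    induction i with
    | zero => exact Submodule.subset_span ⟨0, by simp, by simp [hu0]⟩
    | succ i ih =>
      rw [pow_succ', Module.End.mul_apply]
      have : Submodule.span F (u '' {j | j ≤ i}) ≤
          (Submodule.span F (u '' {j | j ≤ i + 1})).comap M := by
        rw [Submodule.span_le]
        rintro _ ⟨j, hj, rfl⟩
        simp only [Set.mem_ofPred_eq] at hj
        rw [SetLike.mem_coe, Submodule.mem_comap, hus]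
        refine add_mem (Submodule.subset_span ⟨j + 1, by simp; omega, rfl⟩)
          (Submodule.smul_mem _ _ (Submodule.subset_span ⟨j, by simp; omega, rfl⟩))
      exact this ih
  let c' : Fin (N + 1) → V := fun j => u (N - j)
  have hspan : ⊤ ≤ Submodule.span F (Set.range c') := by
    rw [← hv, Submodule.span_le]
    rintro _ ⟨i, rfl⟩
    refine Submodule.span_mono ?_ (key i)
    rintro _ ⟨j, hj, rfl⟩
    simp only [Set.mem_ofPred_eq] at hj
    refine ⟨⟨N - j, by omega⟩, ?_⟩
    simp only [c']
    congr 1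
    omega
  refine ⟨basisOfTopLeSpanOfCardEqFinrank c' hspan (by simp [hV]), ?_⟩
  intro j hj
  simp only [coe_basisOfTopLeSpanOfCardEqFinrank, c']
  rw [hus]
  have e1 : N - (j + 1) + 1 = N - j := by omega
  have e2 : N - (N - (j + 1)) = j + 1 := by omega
  rw [e1, e2, add_comm]

end

theorem stmt12 (p l : ℕ) (hp : p.Prime) (hl : 1 ≤ l)
    (F : Type*) [Field F] [Fintype F] [CharP F p] (hcard : Fintype.card F = p ^ l)
    (k n : ℕ) (hk : 1 ≤ k) (hn : 2 ≤ n)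
    (d : ℕ) (hd : d = Nat.gcd k (Fintype.card F - 1))
    (hdq : d ≠ Fintype.card F - 1)
    (hW : ∀ x : F, ∃ f : Fin d → F, x = ∑ i, (f i) ^ d)
    (hcase : (Fintype.card F - 1 ≠ d * (l + 1) ∧ n > l * (p - 1)) ∨
      n > (l + 1) * (p - 1)) :
    ∀ M : Matrix (Fin n) (Fin n) F, IsCyclicMatrix M →
      ∃ A B : Matrix (Fin n) (Fin n) F, M = A ^ k + B ^ k := by
  classical
  intro M hM
  have hnl : l * (p - 1) < n := by
    rcases hcase with h | h
    · exact h.2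
    · have : l * (p - 1) ≤ (l + 1) * (p - 1) := Nat.mul_le_mul_right _ (by omega)
      omega
  obtain ⟨N, rfl⟩ : ∃ N, n = N + 1 := ⟨n - 1, by omega⟩
  obtain ⟨v, hv⟩ := hM
  obtain ⟨s, hs, hT⟩ := aux_comb p l hp hl hcard k N hk d hd hdq hW (by omega) M.trace
  have h0 : (0 : F) ∈ Set.range fun x : F => x ^ k := ⟨0, by simp; omega⟩
  have h1 : (1 : F) ∈ Set.range fun x : F => x ^ k := ⟨1, by simp⟩
  obtain ⟨α, β, hα, hβ, hβ0, hne, ho, hev, htr⟩ := aux_slots _ h0 h1 N M.trace s hs hT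
  let M' : Module.End F (Fin (N + 1) → F) := Matrix.toLinAlgEquiv' M
  have hv' : Submodule.span F (Set.range fun i : Fin (N + 1) => (M' ^ (i : ℕ)) v) = ⊤ := by
    rw [← hv]
    congr 2
    funext i
    simp only [M', ← map_pow]
    rfl
  obtain ⟨c, hc⟩ := aux_cyc N (by simp) M' v hv' (fun j => α j + β j)
  obtain ⟨A, B, hAB⟩ := aux_basis k N (Finset.univ.image fun x : F => x ^ k)
    (by intro a ha; simpa using ha) M' c α β
    (by intro j hj; simpa using hα j hj) (by intro j hj; simpa using hβ j hj) hβ0 hne ho hev hc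
    (by rw [← htr]; exact Matrix.trace_toLin'_eq M)
  refine ⟨Matrix.toLinAlgEquiv'.symm A, Matrix.toLinAlgEquiv'.symm B, ?_⟩
  rw [← map_pow, ← map_pow, ← map_add, ← hAB]
  simp [M']
end

section
/- Set d := gcd(k, q−1). If gcd((q−1)/d, p−1) ≥ 3 and n > p−1, then every cyclic matrix A ∈ M_n(𝔽_q) whose trace lies in the prime subfield 𝔽_p of 𝔽_q can be written as B^k + C^k with B, C ∈ M_n(𝔽_q). -/
open Polynomial in
lemma root_of_annihilated {F R : Type*} [Field F] [Ring R] [Algebra F R] (k : ℕ)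
    (S : Finset F) (hS : ∀ s ∈ S, ∃ g, g ^ k = s) (M : R)
    (hM : aeval M (∏ s ∈ S, (X - C s)) = 0) : ∃ G : R, G ^ k = M := by
  classical
  choose! g hg using hS
  let f : F[X] := Lagrange.interpolate S id g
  have hf : ∀ s ∈ S, f.eval s = g s := fun s hs =>
    Lagrange.eval_interpolate_at_node g (Set.injOn_id _) hs
  have hdvd : (∏ s ∈ S, (X - C s)) ∣ f ^ k - X := by
    refine Finset.prod_dvd_of_coprime ?_ ?_
    · intro a _ b _ hab
      exact pairwise_coprime_X_sub_C (s := (id : F → F)) Function.injective_id hab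
    · intro s hs
      rw [dvd_iff_isRoot, IsRoot.def]
      simp [hf s hs, hg s hs]
  obtain ⟨c, hc⟩ := hdvd
  refine ⟨aeval M f, ?_⟩
  have := congrArg (aeval M) hc
  rw [map_mul, hM, zero_mul, map_sub, map_pow, aeval_X] at this
  exact sub_eq_zero.mp this

open Pointwise in
lemma sums_cover {p : ℕ} (hp : p.Prime) (T : Finset (ZMod p)) (hT : 3 ≤ T.card)
    (J : Finset ℕ) : ∃ W : Finset (ZMod p), min p (2 * J.card + 1) ≤ W.card ∧
      ∀ c ∈ W, ∃ x : ℕ → ZMod p, (∀ i, x i ∈ T) ∧ ∑ i ∈ J, x i = c := by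
  classical
  have hTn : T.Nonempty := Finset.card_pos.mp (by omega)
  obtain ⟨t0, ht0⟩ := hTn
  induction J using Finset.induction_on with
  | empty =>
    refine ⟨{0}, by simp, ?_⟩
    intro c hc
    exact ⟨fun _ => t0, fun _ => ht0, by simpa using (Finset.mem_singleton.mp hc).symm⟩
  | insert a J ha ih =>
    obtain ⟨W, hW, hx⟩ := ih
    have hp0 := hp.pos
    have hWn : W.Nonempty := Finset.card_pos.mp (by omega)
    refine ⟨W + T, ?_, ?_⟩
    · have := ZMod.cauchy_davenport hp hWn ⟨t0, ht0⟩
      rw [Finset.card_insert_of_notMem ha]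
      omega
    · intro c hc
      obtain ⟨w, hw, t, ht, rfl⟩ := Finset.mem_add.mp hc
      obtain ⟨x, hxT, hxs⟩ := hx w hw
      refine ⟨Function.update x a t, ?_, ?_⟩
      · intro i
        by_cases h : i = a
        · subst h; simpa using ht
        · simpa [h] using hxT i
      · rw [Finset.sum_insert ha, Function.update_self, ← hxs, add_comm]
        congr 1
        refine Finset.sum_congr rfl fun i hi => ?_
        rw [Function.update_of_ne]
        rintro rfl; exact ha hi

lemma sums_cover' {p : ℕ} (hp : p.Prime) (T : Finset (ZMod p)) (hT : 3 ≤ T.card)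
    (J : Finset ℕ) (hJ : p ≤ 2 * J.card + 1) (c : ZMod p) :
      ∃ x : ℕ → ZMod p, (∀ i, x i ∈ T) ∧ ∑ i ∈ J, x i = c := by
  have := Fact.mk hp
  obtain ⟨W, hW, hx⟩ := sums_cover hp T hT J
  refine hx c ?_
  have : W = Finset.univ := by
    rw [← Finset.card_eq_iff_eq_univ, ZMod.card]
    have := Finset.card_le_univ W
    rw [ZMod.card] at this
    omega
  simp [this]

lemma exists_root_unity {p : ℕ} (hp : p.Prime) {F : Type*} [Field F] [Fintype F] [CharP F p]
    (k d : ℕ) (hd : d = Nat.gcd k (Fintype.card F - 1))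
    (hgcd : Nat.gcd ((Fintype.card F - 1) / d) (p - 1) ≥ 3) :
    ∃ y : F, 3 ≤ orderOf y ∧ y ≠ 0 ∧ (∃ g, g ^ k = y) ∧ y ^ p = y := by
  classical
  obtain ⟨γ, hγ⟩ := IsCyclic.exists_generator (α := Fˣ)
  have hord : orderOf γ = Fintype.card F - 1 := by
    rw [orderOf_eq_card_of_forall_mem_zpowers hγ, Nat.card_eq_fintype_card, Fintype.card_units]
  set N := Fintype.card F - 1 with hN
  have hNpos : 0 < N := by rw [← hord]; exact orderOf_pos γ
  set e := Nat.gcd (N / d) (p - 1) with he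
  have hdN : d ∣ N := hd ▸ Nat.gcd_dvd_right _ _
  obtain ⟨a, ha⟩ : e ∣ N / d := Nat.gcd_dvd_left _ _
  obtain ⟨b, hb⟩ : e ∣ p - 1 := Nat.gcd_dvd_right _ _
  have hNe : N = e * (d * a) := by
    have := Nat.mul_div_cancel' hdN
    rw [ha] at this
    rw [← this]; ring
  have hda : d * a ≠ 0 := by
    intro h; rw [h] at hNe; omega
  have hoe : orderOf (γ ^ (d * a)) = e := by
    rw [orderOf_pow_of_dvd hda (by rw [hord]; exact ⟨e, by rw [hNe]; ring⟩), hord, hNe]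
    exact Nat.mul_div_cancel _ (Nat.pos_of_ne_zero hda)
  have hpw : ∃ g : Fˣ, g ^ k = γ ^ (d * a) := by
    refine ⟨γ ^ (Nat.gcdA k N * a), ?_⟩
    have h1 : γ ^ (d : ℤ) = γ ^ (k * Nat.gcdA k N) := by
      rw [hd, Nat.gcd_eq_gcd_ab, zpow_add, zpow_mul γ (N : ℤ), ← hord]
      simp [pow_orderOf_eq_one]
    rw [pow_mul, ← zpow_natCast γ d, h1, ← zpow_natCast, ← zpow_natCast, ← zpow_mul, ← zpow_mul]
    congr 1; ring
  obtain ⟨g, hg⟩ := hpw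
  refine ⟨((γ ^ (d * a) : Fˣ) : F), ?_, Units.ne_zero _, ⟨g, by rw [← hg]; simp⟩, ?_⟩
  · rw [orderOf_units, hoe]; exact hgcd
  · rw [← Units.val_pow_eq_pow_val]
    congr 1
    have : p = (p - 1) + 1 := by have := hp.pos; omega
    rw [this, pow_succ, hb, pow_mul, ← hoe, pow_orderOf_eq_one]
    simp

lemma card_J (n : ℕ) : n ≤ 2 * ((Finset.range (n-1)).filter (fun i => (n + i) % 2 = 0)).card + 1 := by
  have : (n / 2) ≤ ((Finset.range (n-1)).filter (fun i => (n + i) % 2 = 0)).card := by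
    calc n / 2 = ((Finset.range (n/2)).image (fun s => n - 2 - 2 * s)).card := by
          rw [Finset.card_image_of_injOn, Finset.card_range]
          intro a ha b hb hab
          simp at ha hb hab
          omega
      _ ≤ _ := by
          apply Finset.card_le_card
          intro i hi
          simp at hi ⊢
          obtain ⟨s, hs, rfl⟩ := hi
          omega
  omega

/-- the shifted Krylov sequence -/
def kry {F V : Type*} [Field F] [AddCommGroup V] [Module F V] (A : Module.End F V) (a : ℕ → F)
    (v : V) : ℕ → V
  | 0 => v
  | j + 1 => A (kry A a v j) - a j • kry A a v j

lemma kry_mem {F V : Type*} [Field F] [AddCommGroup V] [Module F V] (A : Module.End F V)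
    (a : ℕ → F) (v : V) (i : ℕ) :
    (A ^ i) v ∈ Submodule.span F (kry A a v '' Set.Iic i) := by
  induction i with
  | zero => exact Submodule.subset_span ⟨0, by simp, rfl⟩
  | succ i ih =>
    rw [pow_succ', Module.End.mul_apply]
    have : Submodule.span F (kry A a v '' Set.Iic i) ≤
        (Submodule.span F (kry A a v '' Set.Iic (i+1))).comap A := by
      rw [Submodule.span_le]
      rintro _ ⟨j, hj, rfl⟩
      simp only [Set.mem_Iic] at hj
      have h : A (kry A a v j) = kry A a v (j+1) + a j • kry A a v j := by
        simp [kry]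
      simp only [SetLike.mem_coe, Submodule.mem_comap, h]
      refine Submodule.add_mem _ (Submodule.subset_span ⟨j+1, by simpa using hj, rfl⟩)
        (Submodule.smul_mem _ _ (Submodule.subset_span ⟨j, ?_, rfl⟩))
      simp only [Set.mem_Iic]; omega
    exact this ih

open Polynomial in
lemma aeval_kill {F V : Type*} [Field F] [AddCommGroup V] [Module F V] (M : Module.End F V)
    {P Q : F[X]} (h : Q ∣ P) {v : V} (hv : aeval M Q v = 0) : aeval M P v = 0 := by
  obtain ⟨c, rfl⟩ := h
  rw [mul_comm, map_mul, Module.End.mul_apply, hv, map_zero]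

open Polynomial in
lemma core {F : Type*} [Field F] {n : ℕ} (hn : 2 ≤ n) (A : Module.End F (Fin n → F))
    (v : Fin n → F) (hv : Submodule.span F (Set.range fun i : Fin n => (A ^ (i : ℕ)) v) = ⊤)
    (S : Finset F) (y : F) (h0 : (0 : F) ∈ S) (h1 : (1 : F) ∈ S) (hy : y ∈ S) (hy0 : y ≠ 0)
    (hy1 : y ≠ 1) (x a : ℕ → F) (hx : ∀ i, x i ∈ S) (hx0 : ∀ i, x i ≠ 0)
    (ha : ∀ i, a i = if (n + i) % 2 = 0 then x i + y else 1)
    (htr : LinearMap.trace F _ A = ∑ i ∈ Finset.range (n - 1), a i) :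
    ∃ D E : Module.End F (Fin n → F), A = D + E ∧
      aeval D (∏ s ∈ S, (X - C s)) = 0 ∧ aeval E (∏ s ∈ S, (X - C s)) = 0 := by
  classical
  set u := kry A a v with hu
  have hspan : ⊤ ≤ Submodule.span F (Set.range fun i : Fin n => u i) := by
    rw [← hv, Submodule.span_le]
    rintro _ ⟨i, rfl⟩
    refine Submodule.span_mono ?_ (kry_mem A a v i)
    rintro _ ⟨j, hj, rfl⟩
    simp only [Set.mem_Iic] at hj
    exact ⟨⟨j, by omega⟩, rfl⟩
  let b : Module.Basis (Fin n) F (Fin n → F) :=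
    basisOfTopLeSpanOfCardEqFinrank (fun i : Fin n => u i) hspan (by simp)
  have hb : ∀ i : Fin n, b i = u i := fun i => by
    simp [b]
  have hA : ∀ i, A (u i) = a i • u i + u (i + 1) := fun i => by simp [hu, kry]
  let E : Module.End F (Fin n → F) :=
    b.constr F (fun i : Fin n => if (n + i) % 2 = 0 then x i • u i + u (i + 1) else 0)
  have hE1 : ∀ i, i < n → (n + i) % 2 = 0 → E (u i) = x i • u i + u (i + 1) := by
    intro i hi hpar
    have := b.constr_basis F
      (fun i : Fin n => if (n + i) % 2 = 0 then x i • u i + u (i + 1) else 0) ⟨i, hi⟩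
    rw [hb] at this
    exact this.trans (if_pos hpar)
  have hE2 : ∀ i, i < n → (n + i) % 2 ≠ 0 → E (u i) = 0 := by
    intro i hi hpar
    have := b.constr_basis F
      (fun i : Fin n => if (n + i) % 2 = 0 then x i • u i + u (i + 1) else 0) ⟨i, hi⟩
    rw [hb] at this
    exact this.trans (if_neg hpar)
  have hD1 : ∀ i, i < n → (n + i) % 2 = 0 → (A - E) (u i) = y • u i := by
    intro i hi hpar
    rw [LinearMap.sub_apply, hE1 i hi hpar, hA, ha, if_pos hpar, add_smul]
    abel
  have hD2 : ∀ i, i < n → (n + i) % 2 ≠ 0 → (A - E) (u i) = u i + u (i + 1) := by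
    intro i hi hpar
    rw [LinearMap.sub_apply, hE2 i hi hpar, hA, ha, if_neg hpar, one_smul, sub_zero]
  -- the last coordinate vanishes
  have hlast : b.repr (A (u (n - 1))) ⟨n - 1, by omega⟩ = 0 := by
    obtain ⟨m, rfl⟩ : ∃ m, n = m + 1 := ⟨n - 1, by omega⟩
    have h2 := LinearMap.trace_eq_matrix_trace F b A
    rw [htr, Matrix.trace, Fin.sum_univ_castSucc, ← Fin.sum_univ_eq_sum_range] at h2
    have h3 : ∀ i : Fin m, (LinearMap.toMatrix b b A).diag i.castSucc = a i := by
      intro i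
      have e : u (i + 1) = b i.succ := by rw [hb]; simp
      have e' : u i = b i.castSucc := by rw [hb]; simp
      rw [Matrix.diag_apply, LinearMap.toMatrix_apply, hb, Fin.val_castSucc, hA, e, e']
      simp [Fin.ext_iff]
    simp only [h3] at h2
    have h4 := left_eq_add.mp h2
    rw [Matrix.diag_apply, LinearMap.toMatrix_apply, hb] at h4
    exact h4
  have hQ : ∀ i : Fin n, (i : ℕ) < n - 1 →
      aeval (A - E) ((X - C 1) * (X - C y)) (b i) = 0 := by
    intro i hi
    rw [hb]
    have hi' := i.2
    simp only [map_mul, map_sub, aeval_X, aeval_C, Module.End.mul_apply]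
    by_cases hpar : (n + (i : ℕ)) % 2 = 0
    · have h : (A - E - algebraMap F (Module.End F (Fin n → F)) y) (u i) = 0 := by
        rw [LinearMap.sub_apply (A - E), hD1 _ hi' hpar]; simp
      exact (congrArg _ h).trans (map_zero _)
    · have e1 := hD2 _ hi' hpar
      have e2 := hD1 (i + 1) (by omega) (by omega)
      simp only [LinearMap.sub_apply (A - E), map_sub, map_add, e1, e2,
        Module.algebraMap_end_apply, one_smul, map_smul]
      module
  have hd2 : (X - C 1) * (X - C y) * X ∣ ∏ s ∈ S, (X - C s) := by
    have := Finset.prod_dvd_prod_of_subset ({1, y, 0} : Finset F) S (fun s => X - C s) (by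
      intro s hs; simp only [Finset.mem_insert, Finset.mem_singleton] at hs
      rcases hs with rfl | rfl | rfl <;> assumption)
    rw [Finset.prod_insert (by simp [hy1.symm]), Finset.prod_insert (by simp [hy0]),
      Finset.prod_singleton, C_0, sub_zero, ← mul_assoc] at this
    exact this
  have hd3 : ∀ i, (X - C (x i)) * X ∣ ∏ s ∈ S, (X - C s) := by
    intro i
    have := Finset.prod_dvd_prod_of_subset ({x i, 0} : Finset F) S (fun s => X - C s) (by
      intro s hs; simp only [Finset.mem_insert, Finset.mem_singleton] at hs
      rcases hs with rfl | rfl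
      · exact hx i
      · exact h0)
    rw [Finset.prod_insert (by simp [hx0]), Finset.prod_singleton, C_0, sub_zero] at this
    exact this
  refine ⟨A - E, E, by abel, b.ext fun i => ?_, b.ext fun i => ?_⟩
  · rw [LinearMap.zero_apply]
    by_cases hi : (i : ℕ) < n - 1
    · exact aeval_kill _ (dvd_trans ⟨X, rfl⟩ hd2) (hQ i hi)
    · apply aeval_kill _ hd2
      have hin : (i : ℕ) = n - 1 := by omega
      rw [map_mul, Module.End.mul_apply, aeval_X, hb, LinearMap.sub_apply,
        hE2 _ i.2 (by omega), sub_zero, hin, ← b.sum_repr (A (u (n - 1))), map_sum]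
      refine Finset.sum_eq_zero fun j _ => ?_
      rw [map_smul]
      by_cases hj : (j : ℕ) < n - 1
      · rw [hQ j hj, smul_zero]
      · have : j = ⟨n - 1, by omega⟩ := Fin.ext (by simp; omega)
        rw [this, hlast, zero_smul]
  · rw [LinearMap.zero_apply, hb]
    have hi' := i.2
    apply aeval_kill _ (hd3 i)
    rw [map_mul, Module.End.mul_apply, aeval_X]
    by_cases hpar : (n + (i : ℕ)) % 2 = 0
    · have e1 := hE1 _ hi' hpar
      have e2 := hE2 (i + 1) (by omega) (by omega)
      simp only [map_sub, aeval_X, aeval_C, LinearMap.sub_apply, e1, e2, map_add, map_smul,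
        Module.algebraMap_end_apply]
      module
    · rw [hE2 _ hi' hpar, map_zero]

theorem stmt13 (p : ℕ) (hp : p.Prime) (F : Type*) [Field F] [Fintype F] [CharP F p]
    (k n : ℕ) (hk : 1 ≤ k) (hn : 2 ≤ n)
    (d : ℕ) (hd : d = Nat.gcd k (Fintype.card F - 1))
    (hgcd : Nat.gcd ((Fintype.card F - 1) / d) (p - 1) ≥ 3)
    (hnp : n > p - 1) :
    ∀ A : Matrix (Fin n) (Fin n) F, IsCyclicMatrix A →
      (∃ m : ℕ, Matrix.trace A = (m : F)) →
        ∃ B C : Matrix (Fin n) (Fin n) F, A = B ^ k + C ^ k := by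
  classical
  rintro A ⟨v, hv⟩ ⟨m, hm⟩
  have := Fact.mk hp
  obtain ⟨y, hyo, hy0, ⟨g, hg⟩, hyp⟩ := exists_root_unity hp k d hd hgcd
  have hy1 : y ≠ 1 := by
    rintro rfl; simp at hyo
  have hy2 : y ^ 2 ≠ 1 := by
    intro h
    have := Nat.le_of_dvd (by norm_num) (orderOf_dvd_of_pow_eq_one h)
    omega
  have hy12 : y ^ 2 ≠ y := by
    intro h
    rw [pow_two] at h
    exact hy1 (mul_left_cancel₀ hy0 (by rw [h, mul_one]))
  let φ : ZMod p →+* F := ZMod.castHom (m := p) dvd_rfl F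
  obtain ⟨z, hz⟩ : ∃ z : ZMod p, φ z = y := by
    have h := (Subfield.mem_bot_iff_pow_eq_self F p).mpr hyp
    rw [← ZMod.fieldRange_castHom_eq_bot p] at h
    exact h
  have hT : 3 ≤ ({1, z, z ^ 2} : Finset (ZMod p)).card := by
    rw [Finset.card_insert_of_notMem, Finset.card_insert_of_notMem, Finset.card_singleton]
    · rw [Finset.mem_singleton]
      intro h
      apply hy12
      rw [← hz, ← map_pow, ← h]
    · simp only [Finset.mem_insert, Finset.mem_singleton, not_or]
      constructor
      · intro h; apply hy1; rw [← hz, ← h, map_one]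
      · intro h; apply hy2; rw [← hz, ← map_pow, ← h, map_one]
  set J := (Finset.range (n-1)).filter (fun i => (n + i) % 2 = 0) with hJdef
  have hJ := card_J n
  set J' := (Finset.range (n-1)).filter (fun i => ¬ (n + i) % 2 = 0) with hJ'def
  obtain ⟨x, hxT, hxs⟩ := sums_cover' hp _ hT J (by rw [← hJdef] at hJ; omega)
    ((m : ZMod p) - J.card * z - J'.card)
  have hx : ∀ i, φ (x i) = 1 ∨ φ (x i) = y ∨ φ (x i) = y ^ 2 := by
    intro i
    have := hxT i
    simp only [Finset.mem_insert, Finset.mem_singleton] at this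
    rcases this with h | h | h
    · left; rw [h, map_one]
    · right; left; rw [h, hz]
    · right; right; rw [h, map_pow, hz]
  let S : Finset F := {0, 1, y, y ^ 2}
  have hS : ∀ s ∈ S, ∃ g, g ^ k = s := by
    intro s hs
    simp only [S, Finset.mem_insert, Finset.mem_singleton] at hs
    rcases hs with rfl | rfl | rfl | rfl
    · exact ⟨0, zero_pow (by omega)⟩
    · exact ⟨1, one_pow k⟩
    · exact ⟨g, hg⟩
    · exact ⟨g ^ 2, by rw [← hg, ← pow_mul, ← pow_mul, mul_comm]⟩
  obtain ⟨D, E, hDE, hD, hE⟩ := core hn (Matrix.toLin' A) v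
    (by simpa only [← Matrix.toLin'_pow, Matrix.toLin'_apply] using hv) S y
    (by simp [S]) (by simp [S]) (by simp [S]) hy0 hy1
    (fun i => φ (x i)) (fun i => if (n + i) % 2 = 0 then φ (x i) + y else 1)
    (by intro i; rcases hx i with h | h | h <;> simp [S, h])
    (by intro i; rcases hx i with h | h | h <;> simp [h, hy0])
    (fun i => rfl)
    (by
      rw [Matrix.trace_toLin'_eq, hm, Finset.sum_ite, Finset.sum_add_distrib,
        ← hJdef, ← hJ'def, ← map_sum, hxs]
      simp [hz]
      ring)
  obtain ⟨B, hB⟩ := root_of_annihilated k S hS D hD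
  obtain ⟨C, hC⟩ := root_of_annihilated k S hS E hE
  refine ⟨LinearMap.toMatrix' B, LinearMap.toMatrix' C, ?_⟩
  apply Matrix.toLin'.injective
  rw [map_add, Matrix.toLin'_pow, Matrix.toLin'_pow, Matrix.toLin'_toMatrix',
    Matrix.toLin'_toMatrix', hB, hC, hDE]
end

section
/- Suppose q = p is prime, p > d+1 where d := gcd(k, p−1), and p does not divide k. If n > (p−1)/2 and p^n > (k−1)^4, then every matrix in M_n(𝔽_p) can be written as A^k + B^k with A, B ∈ M_n(𝔽_p). If moreover n > (p−1)/2, p^n > (k−1)^4 + 4k, and p·(p^n−1)/gcd(k, p^n−1) is even, then every matrix in M_n(𝔽_p) can be written as A^k + B^k with A, B ∈ GL_n(𝔽_p). -/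
lemma jac_norm {F : Type*} [Field F] [Fintype F] {χ φ : MulChar F ℂ} (hχ : χ ≠ 1) (hφ : φ ≠ 1)
    (h : χ * φ ≠ 1) : ‖jacobiSum χ φ‖ = Real.sqrt (Fintype.card F) := by
  have hc : ringChar ℂ ≠ ringChar F := by
    rw [ringChar.eq_zero]
    intro h0
    have := ringChar.of_eq h0.symm
    exact CharP.char_ne_zero_of_finite F 0 rfl
  have h1 := jacobiSum_mul_jacobiSum_inv hc hχ hφ h
  have h2 : jacobiSum χ⁻¹ φ⁻¹ = star (jacobiSum χ φ) := by
    simp only [jacobiSum, star_sum, star_mul', MulChar.star_apply']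
  rw [h2] at h1
  have h3 : ‖jacobiSum χ φ‖ * ‖jacobiSum χ φ‖ = Fintype.card F := by
    have := congrArg norm h1
    simpa using this
  rw [← h3, Real.sqrt_mul_self (norm_nonneg _)]

lemma pow_of_char {F : Type*} [Field F] [Fintype F] {χ : MulChar F ℂ} {u : F} (hu : u ≠ 0)
    (h : χ u = 1) : ∃ a : F, a ≠ 0 ∧ a ^ orderOf χ = u := by
  classical
  obtain ⟨g, hg⟩ := IsCyclic.exists_generator (α := Fˣ)
  obtain ⟨m, hm⟩ := (hg (Units.mk0 u hu))
  obtain ⟨m, hm⟩ := (mem_powers_iff_mem_zpowers (x := g)).2 (hg (Units.mk0 u hu))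
  simp only at hm
  have hu' : u = (g : F) ^ m := by
    have := congrArg Units.val hm
    simpa using this.symm
  have h1 : χ ^ m = 1 := by
    rw [MulChar.eq_iff hg]
    rw [MulChar.pow_apply_coe, ← map_pow, ← hu', h, MulChar.one_apply_coe]
  obtain ⟨t, ht⟩ := orderOf_dvd_of_pow_eq_one h1
  refine ⟨(g : F) ^ t, pow_ne_zero _ g.ne_zero, ?_⟩
  rw [hu', ht, ← pow_mul, mul_comm]

lemma char_sum {F : Type*} [Field F] [Fintype F] {χ : MulChar F ℂ} {u : F}
    (h : ∑ i ∈ Finset.range (orderOf χ), (χ ^ i) u ≠ 0) : u ≠ 0 ∧ χ u = 1 := by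
  have hu : u ≠ 0 := by
    rintro rfl
    exact h (Finset.sum_eq_zero fun i _ => MulChar.map_zero _)
  refine ⟨hu, ?_⟩
  have e : ∀ i, (χ ^ i) u = (χ u) ^ i := fun i => by
    simpa using MulChar.pow_apply_coe χ i (Units.mk0 u hu)
  simp only [e] at h
  by_contra h1
  have := geom_sum_eq h1 (orderOf χ)
  rw [← e, pow_orderOf_eq_one, MulChar.one_apply (Ne.isUnit hu), sub_self, zero_div] at this
  exact h this

lemma char_norm_le {F : Type*} [Field F] [Fintype F] (χ : MulChar F ℂ) (u : F) : ‖χ u‖ ≤ 1 := by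
  classical
  by_cases hu : u = 0
  · simp [hu, MulChar.map_zero]
  · have h1 : χ u ^ (Fintype.card F - 1) = 1 := by
      rw [← map_pow, FiniteField.pow_card_sub_one_eq_one u hu, map_one]
    have := Fintype.one_lt_card (α := F)
    exact (Complex.norm_eq_one_of_pow_eq_one h1 (by omega)).le

lemma arith {q d : ℕ} (hd1 : 1 ≤ d) (hq9 : 9 ≤ q) (hq : (d - 1) ^ 4 < q) :
    ((d:ℝ) - 1) + (d - 1) * (d * Real.sqrt q + 2 * (1 - Real.sqrt q)) < q - 2 := by
  obtain ⟨c, rfl⟩ : ∃ c, d = c + 1 := ⟨d - 1, by omega⟩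
  simp only [Nat.add_sub_cancel] at hq
  set s := Real.sqrt q with hs
  have hss : s ^ 2 = q := Real.sq_sqrt (by positivity)
  have hq' : (c:ℝ) ^ 4 < q := by exact_mod_cast hq
  have hq9' : (9:ℝ) ≤ q := by exact_mod_cast hq9
  have hs0 : 0 ≤ s := Real.sqrt_nonneg _
  have hsc : (c:ℝ) ^ 2 < s := by
    apply lt_of_pow_lt_pow_left₀ 2 hs0
    rw [hss]; calc _ = (c:ℝ) ^ 4 := by ring
      _ < _ := hq'
  push_cast
  rw [← hss] at hq9' ⊢
  rcases c with _ | _ | c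
  · norm_num; nlinarith
  · norm_num; nlinarith
  · set x : ℝ := (c:ℝ) with hx
    have hx0 : 0 ≤ x := by positivity
    push_cast at hsc ⊢
    have h1 : 0 ≤ s * (s - (x+1+1)^2) := mul_nonneg hs0 (by linarith)
    have h2 : (x+1+1) * (x+1+1)^2 < (x+1+1) * s := mul_lt_mul_of_pos_left hsc (by linarith)
    nlinarith [mul_nonneg hx0 hx0, mul_nonneg hx0 (mul_nonneg hx0 hx0)]

theorem fermat {F : Type*} [Field F] [Fintype F] (d : ℕ) (hd1 : 1 ≤ d)
    (hd : d ∣ Fintype.card F - 1) (hq9 : 9 ≤ Fintype.card F)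
    (hq : (d - 1) ^ 4 < Fintype.card F) (l : F) (hl : l ≠ 0) :
    ∃ a b : F, a ≠ 0 ∧ b ≠ 0 ∧ a ^ d + b ^ d = l := by
  classical
  obtain ⟨χ, hχ⟩ := MulChar.exists_mulChar_orderOf F hd (Complex.isPrimitiveRoot_exp d (by omega))
  by_contra hcon
  have hT : ∑ u : F, (∑ i ∈ Finset.range d, (χ ^ i) u) * (∑ j ∈ Finset.range d, (χ ^ j) (l - u)) = 0 := by
    refine Finset.sum_eq_zero fun u _ => ?_
    by_contra hne
    rw [← hχ] at hne
    obtain ⟨h1, h2⟩ := char_sum (left_ne_zero_of_mul hne)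
    obtain ⟨h3, h4⟩ := char_sum (right_ne_zero_of_mul hne)
    obtain ⟨a, ha, ha'⟩ := pow_of_char h1 h2
    obtain ⟨b, hb, hb'⟩ := pow_of_char h3 h4
    exact hcon ⟨a, b, ha, hb, by rw [← hχ, ha', hb']; ring⟩
  have hT2 : ∑ u : F, (∑ i ∈ Finset.range d, (χ ^ i) u) * (∑ j ∈ Finset.range d, (χ ^ j) (l - u))
      = ∑ i ∈ Finset.range d, ∑ j ∈ Finset.range d,
        ((χ ^ i) l * (χ ^ j) l) * jacobiSum (χ ^ i) (χ ^ j) := by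
    rw [← Equiv.sum_comp (Equiv.mulLeft₀ l hl)]
    simp only [Finset.sum_mul_sum]
    rw [Finset.sum_comm]
    refine Finset.sum_congr rfl fun i _ => ?_
    rw [Finset.sum_comm]
    refine Finset.sum_congr rfl fun j _ => ?_
    rw [jacobiSum, Finset.mul_sum]
    refine Finset.sum_congr rfl fun u _ => ?_
    rw [show l - (Equiv.mulLeft₀ l hl) u = l * (1 - u) by simp [mul_sub]]
    rw [show (Equiv.mulLeft₀ l hl) u = l * u by simp, map_mul, map_mul]
    ring
  rw [hT2] at hT
  set s := Real.sqrt (Fintype.card F) with hs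
  have hs1 : 1 ≤ s := by
    rw [hs, Real.one_le_sqrt]; exact_mod_cast (by omega : 1 ≤ Fintype.card F)
  have hpow : ∀ i, χ ^ i = 1 ↔ d ∣ i := fun i => by rw [← hχ, orderOf_dvd_iff_pow_eq_one]
  set t : ℕ → ℕ → ℂ := fun i j => ((χ ^ i) l * (χ ^ j) l) * jacobiSum (χ ^ i) (χ ^ j) with ht
  have htn : ∀ i j, ‖t i j‖ ≤ ‖jacobiSum (χ ^ i) (χ ^ j)‖ := fun i j => by
    rw [ht]; simp only [norm_mul]
    have := mul_le_one₀ (char_norm_le (χ ^ i) l) (norm_nonneg _) (char_norm_le (χ ^ j) l)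
    exact mul_le_of_le_one_left (norm_nonneg _) this
  have t00 : t 0 0 = (Fintype.card F : ℂ) - 2 := by
    simp [ht, jacobiSum_one_one, MulChar.one_apply (Ne.isUnit hl)]
  have t0j : ∀ j, 0 < j → j < d → ‖t 0 j‖ ≤ 1 := fun j h0 h1 => by
    refine (htn 0 j).trans ?_
    rw [pow_zero, jacobiSum_one_nontrivial]
    · simp
    · rw [Ne, hpow]; exact Nat.not_dvd_of_pos_of_lt h0 h1
  have ti0 : ∀ j, 0 < j → j < d → ‖t j 0‖ ≤ 1 := fun j h0 h1 => by
    have := t0j j h0 h1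
    simpa only [ht, jacobiSum_comm (χ ^ j), mul_comm ((χ ^ j) l)] using this
  have tij : ∀ i j, 0 < i → i < d → 0 < j → j < d → j ≠ d - i → ‖t i j‖ ≤ s := by
    intro i j h0 h1 h2 h3 h4
    refine (htn i j).trans (le_of_eq ?_)
    apply jac_norm
    · rw [Ne, hpow]; exact Nat.not_dvd_of_pos_of_lt h0 h1
    · rw [Ne, hpow]; exact Nat.not_dvd_of_pos_of_lt h2 h3
    · rw [← pow_add, Ne, hpow]
      rintro ⟨m, hm⟩
      rcases m with _ | _ | m
      · omega
      · omega
      · nlinarith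
  have tinv : ∀ i, 0 < i → i < d → ‖t i (d - i)‖ ≤ 1 := by
    intro i h0 h1
    refine (htn _ _).trans ?_
    have : χ ^ (d - i) = (χ ^ i)⁻¹ := by
      rw [eq_inv_iff_mul_eq_one, ← pow_add, hpow]; exact ⟨1, by omega⟩
    rw [this, jacobiSum_nontrivial_inv, norm_neg]
    · exact char_norm_le _ _
    · rw [Ne, hpow]; exact Nat.not_dvd_of_pos_of_lt h0 h1
  have row : ∀ i ∈ Finset.Ico 1 d, ‖∑ j ∈ Finset.range d, t i j‖ ≤ d * s + 2 * (1 - s) := by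
    intro i hi
    rw [Finset.mem_Ico] at hi
    calc ‖∑ j ∈ Finset.range d, t i j‖ ≤ ∑ j ∈ Finset.range d, ‖t i j‖ := norm_sum_le _ _
      _ ≤ ∑ j ∈ Finset.range d, (s + (if j = 0 then (1 - s) else 0) + (if j = d - i then 1 - s else 0)) := by
        refine Finset.sum_le_sum fun j hj => ?_
        rw [Finset.mem_range] at hj
        by_cases hj0 : j = 0
        · subst hj0
          rw [if_pos rfl, if_neg (by omega)]
          linarith [ti0 i (by omega) hi.2]
        · by_cases hj1 : j = d - i
          · rw [if_neg hj0, if_pos hj1, hj1]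
            linarith [tinv i (by omega) hi.2]
          · rw [if_neg hj0, if_neg hj1]
            linarith [tij i j (by omega) hi.2 (by omega) hj hj1]
      _ = _ := by
        rw [Finset.sum_add_distrib, Finset.sum_add_distrib, Finset.sum_ite_eq', Finset.sum_ite_eq',
          if_pos (by simp; omega), if_pos (by simp; omega)]
        simp; ring
  have row0 : ‖∑ j ∈ Finset.Ico 1 d, t 0 j‖ ≤ (d:ℝ) - 1 := by
    calc _ ≤ ∑ j ∈ Finset.Ico 1 d, ‖t 0 j‖ := norm_sum_le _ _
      _ ≤ ∑ j ∈ Finset.Ico 1 d, 1 := Finset.sum_le_sum fun j hj => by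
        rw [Finset.mem_Ico] at hj; exact t0j j (by omega) hj.2
      _ = _ := by simp [Nat.cast_sub hd1]
  have rows : ‖∑ i ∈ Finset.Ico 1 d, ∑ j ∈ Finset.range d, t i j‖ ≤ ((d:ℝ) - 1) * (d * s + 2 * (1 - s)) := by
    calc _ ≤ ∑ i ∈ Finset.Ico 1 d, ‖∑ j ∈ Finset.range d, t i j‖ := norm_sum_le _ _
      _ ≤ ∑ i ∈ Finset.Ico 1 d, ((d:ℝ) * s + 2 * (1 - s)) := Finset.sum_le_sum row
      _ = _ := by rw [Finset.sum_const, Nat.card_Ico, nsmul_eq_mul, Nat.cast_sub hd1, Nat.cast_one]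
  have e1 : t 0 0 = -(∑ j ∈ Finset.Ico 1 d, t 0 j) - ∑ i ∈ Finset.Ico 1 d, ∑ j ∈ Finset.range d, t i j := by
    have : ∑ i ∈ Finset.range d, ∑ j ∈ Finset.range d, t i j = 0 := hT
    rw [Finset.range_eq_Ico, Finset.sum_eq_sum_Ico_succ_bot (by omega),
      Finset.sum_eq_sum_Ico_succ_bot (by omega)] at this
    rw [Finset.range_eq_Ico]
    linear_combination this
  have e2 : ‖t 0 0‖ = (Fintype.card F : ℝ) - 2 := by
    rw [t00]
    have : ((Fintype.card F : ℂ) - 2) = (((Fintype.card F : ℝ) - 2 : ℝ) : ℂ) := by push_cast; rfl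
    rw [this, Complex.norm_real, Real.norm_of_nonneg]
    have : (9:ℝ) ≤ Fintype.card F := by exact_mod_cast hq9
    linarith
  have e3 : ‖t 0 0‖ ≤ ((d:ℝ) - 1) + (d - 1) * (d * s + 2 * (1 - s)) := by
    rw [e1]
    refine (norm_sub_le _ _).trans ?_
    rw [norm_neg]
    exact add_le_add row0 rows
  have := arith hd1 hq9 hq
  linarith
open Matrix Polynomial

/-- extracting k-th roots of triangular matrices -/
lemma root_upper {p : ℕ} [Fact p.Prime] {k n : ℕ} (hpk : ¬ p ∣ k)
    (L : Matrix (Fin n) (Fin n) (ZMod p)) (hL : L.BlockTriangular id)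
    (hdiag : ∀ i, L i i ≠ 0 ∧ ∃ c, c ^ k = L i i) : ∃ A, IsUnit A ∧ A ^ k = L := by
  classical
  have hp := (Fact.out : p.Prime)
  have hk0 : k ≠ 0 := by rintro rfl; simp at hpk
  have hLu : IsUnit L := by
    rw [Matrix.isUnit_iff_isUnit_det, Matrix.det_of_isUpperTriangular hL]
    exact (Finset.prod_ne_zero_iff.2 fun i _ => (hdiag i).1).isUnit
  have : ∃ r : ZMod p → ZMod p, ∀ i, r (L i i) ^ k = L i i := by
    refine ⟨fun a => if h : ∃ c, c ^ k = a then h.choose else 0, fun i => ?_⟩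
    simp only [dif_pos (hdiag i).2]
    exact (hdiag i).2.choose_spec
  obtain ⟨r, hr⟩ := this
  let Q : (ZMod p)[X] := Lagrange.interpolate Finset.univ id r
  have hQ : ∀ a, Q.eval a = r a := fun a =>
    Lagrange.eval_interpolate_at_node r (Function.injective_id.injOn) (Finset.mem_univ a)
  have hdvd : L.charpoly ∣ (Q ^ k - X) ^ n := by
    rw [Matrix.charpoly_of_isUpperTriangular L hL]
    calc ∏ i : Fin n, (X - C (L i i)) ∣ ∏ i : Fin n, (Q ^ k - X) := by
          refine Finset.prod_dvd_prod_of_dvd _ _ fun i _ => ?_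
          rw [dvd_iff_isRoot]
          simp [hQ, hr]
      _ = _ := by simp
  set D0 := aeval L Q with hD0
  have hnil : (D0 ^ k - L) ^ n = 0 := by
    obtain ⟨R, hR⟩ := hdvd
    have := congrArg (aeval L) hR
    simpa [Matrix.aeval_self_charpoly] using this
  have hcomm : Commute D0 L := by
    have : Commute (aeval L Q) (aeval L (X : (ZMod p)[X])) := by
      rw [commute_iff_eq, ← map_mul, ← map_mul, mul_comm]
    simpa using this
  have hnil2 : (D0 ^ k - L) ^ p ^ n = 0 :=
    pow_eq_zero_of_le (Nat.lt_pow_self hp.one_lt).le hnil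
  rcases isEmpty_or_nonempty (Fin n) with hE | hE
  · exact ⟨L, hLu, Subsingleton.elim _ _⟩
  rw [sub_pow_char_pow_of_commute p _ (hcomm.pow_left k), sub_eq_zero] at hnil2
  have hD : (D0 ^ p ^ n) ^ k = L ^ p ^ n := by rw [← hnil2, ← pow_mul, ← pow_mul, mul_comm]
  have hDu : IsUnit (D0 ^ p ^ n) := by
    rw [← isUnit_pow_iff hk0, hD]; exact hLu.pow _
  obtain ⟨u, hu⟩ := hDu
  obtain ⟨v, hv⟩ := hLu
  have huv : Commute u v := by
    apply Units.ext
    have := (hcomm.pow_left (p ^ n)).eq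
    rw [← hu, ← hv] at this
    simpa using this
  have hE : u ^ k = v ^ p ^ n := by
    apply Units.ext; push_cast; rw [hu, hv, hD]
  have hcop : IsCoprime (k : ℤ) ((p ^ n : ℕ) : ℤ) := by
    rw [Nat.isCoprime_iff_coprime]
    exact (Nat.Coprime.pow_left n ((Nat.Prime.coprime_iff_not_dvd hp).2 hpk)).symm
  obtain ⟨a, b, hab⟩ := hcop
  refine ⟨((v ^ a * u ^ b : (Matrix (Fin n) (Fin n) (ZMod p))ˣ) : Matrix (Fin n) (Fin n) (ZMod p)),
    Units.isUnit _, ?_⟩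
  rw [← Units.val_pow_eq_pow_val, ← hv]
  congr 1
  have e1 : (v ^ a) ^ k = v ^ (a * k) := by rw [_root_.zpow_mul, zpow_natCast]
  have e2 : (u ^ b) ^ k = v ^ (b * ((p ^ n : ℕ) : ℤ)) := by
    rw [← zpow_natCast, ← _root_.zpow_mul, mul_comm b, _root_.zpow_mul, zpow_natCast, hE,
      ← zpow_natCast, ← _root_.zpow_mul, mul_comm]
  rw [(huv.symm.zpow_zpow a b).mul_pow, e1, e2, ← _root_.zpow_add, hab, zpow_one]

lemma root_lower {p : ℕ} [Fact p.Prime] {k n : ℕ} (hpk : ¬ p ∣ k)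
    (L : Matrix (Fin n) (Fin n) (ZMod p)) (hL : Lᵀ.BlockTriangular id)
    (hdiag : ∀ i, L i i ≠ 0 ∧ ∃ c, c ^ k = L i i) : ∃ A, IsUnit A ∧ A ^ k = L := by
  obtain ⟨A, hA, h⟩ := root_upper hpk Lᵀ hL hdiag
  refine ⟨Aᵀ, ?_, ?_⟩
  · rwa [Matrix.isUnit_transpose]
  · rw [← Matrix.transpose_pow, h, Matrix.transpose_transpose]
open Matrix

def GoodDiag {K ι : Type} [Field K] [Fintype ι] [DecidableEq ι] (M : Matrix ι ι K) (d : ι → K) : Prop :=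
  ∃ P Q : Matrix ι ι K, P * Q = 1 ∧ Q * P = 1 ∧ ∀ i, (Q * M * P) i i = d i

lemma GoodDiag.sim {K ι : Type} [Field K] [Fintype ι] [DecidableEq ι] {M P Q : Matrix ι ι K}
    {d : ι → K} (h1 : P * Q = 1) (h2 : Q * P = 1) (h : GoodDiag (Q * M * P) d) : GoodDiag M d := by
  obtain ⟨R, S, h3, h4, h5⟩ := h
  refine ⟨P * R, S * Q, ?_, ?_, ?_⟩
  · rw [show P * R * (S * Q) = P * (R * S) * Q by simp only [Matrix.mul_assoc], h3, Matrix.mul_one, h1]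
  · rw [show S * Q * (P * R) = S * (Q * P) * R by simp only [Matrix.mul_assoc], h2, Matrix.mul_one, h4]
  · intro i
    rw [← h5 i]
    simp only [Matrix.mul_assoc]

lemma GoodDiag.equiv {K ι κ : Type} [Field K] [Fintype ι] [DecidableEq ι] [Fintype κ] [DecidableEq κ]
    (e : κ ≃ ι) {M : Matrix ι ι K}
    {d : ι → K} (h : GoodDiag (M.submatrix e e) (d ∘ e)) : GoodDiag M d := by
  obtain ⟨R, S, h3, h4, h5⟩ := h
  refine ⟨R.submatrix e.symm e.symm, S.submatrix e.symm e.symm, ?_, ?_, ?_⟩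
  · rw [Matrix.submatrix_mul_equiv, h3, Matrix.submatrix_one_equiv]
  · rw [Matrix.submatrix_mul_equiv, h4, Matrix.submatrix_one_equiv]
  · intro i
    have hM : M = (M.submatrix e e).submatrix e.symm e.symm := by simp
    rw [hM, Matrix.submatrix_mul_equiv, Matrix.submatrix_mul_equiv, Matrix.submatrix_apply, h5]
    simp

lemma exists_vec {K ι : Type} [Field K] [Fintype ι] [DecidableEq ι] (M : Matrix ι ι K)
    (h : ¬ ∃ c : K, M = c • (1 : Matrix ι ι K)) : ∃ v : ι → K, ∀ a : K, M *ᵥ v ≠ a • v := by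
  by_contra hcon
  push Not at hcon
  have h1 : ∀ i j, i ≠ j → M i j = 0 := by
    intro i j hij
    obtain ⟨a, ha⟩ := hcon (Pi.single j 1)
    have := congrFun ha i
    simpa [hij] using this
  have h2 : ∀ i j, M i i = M j j := by
    intro i j
    by_cases hij : i = j
    · rw [hij]
    obtain ⟨a, ha⟩ := hcon (Pi.single i 1 + Pi.single j 1)
    have e1 := congrFun ha i
    have e2 := congrFun ha j
    simp [Matrix.mulVec_add, hij, Ne.symm hij, h1 _ _ hij, h1 _ _ (Ne.symm hij)] at e1 e2
    rw [e1, e2]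
  rcases isEmpty_or_nonempty ι with hE | ⟨⟨i0⟩⟩
  · exact h ⟨0, Subsingleton.elim _ _⟩
  · refine h ⟨M i0 i0, ?_⟩
    ext i j
    by_cases hij : i = j
    · subst hij; simp [h2 i i0]
    · simp [hij, h1 i j hij]

lemma exists_conj {K : Type} [Field K] {n : ℕ} (M : Matrix (Fin (n+1)) (Fin (n+1)) K)
    (h : ¬ ∃ c : K, M = c • (1 : Matrix (Fin (n+1)) (Fin (n+1)) K)) :
    ∃ P Q : Matrix (Fin (n+1)) (Fin (n+1)) K, P * Q = 1 ∧ Q * P = 1 ∧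
      ∃ i : Fin n, (Q * M * P) i.succ 0 ≠ 0 := by
  obtain ⟨v, hv⟩ := exists_vec M h
  have hv0 : v ≠ 0 := by rintro rfl; exact hv 0 (by simp)
  obtain ⟨i, hi⟩ := Function.ne_iff.1 hv0
  let P0 : Matrix (Fin (n+1)) (Fin (n+1)) K := (1 : Matrix (Fin (n+1)) (Fin (n+1)) K).updateCol i v
  let P : Matrix (Fin (n+1)) (Fin (n+1)) K := P0.submatrix id (Equiv.swap 0 i)
  have hdet0 : P0.det = v i := by
    have := Matrix.cramer_apply (1 : Matrix (Fin (n+1)) (Fin (n+1)) K) v i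
    rw [Matrix.cramer_one] at this
    exact this.symm
  have hdet : IsUnit P.det := by
    rw [Matrix.det_permute', hdet0]
    refine IsUnit.mul ?_ (Ne.isUnit hi)
    exact ((Int.isUnit_iff.2 (by rcases Int.units_eq_one_or (Equiv.Perm.sign (Equiv.swap 0 i)) with h | h <;> simp [h]) : IsUnit ((Equiv.Perm.sign (Equiv.swap 0 i) : ℤˣ) : ℤ))).map (Int.castRingHom K)
  have hcol : P *ᵥ (Pi.single 0 1) = v := by
    ext j; simp [P, P0]
  refine ⟨P, P⁻¹, Matrix.mul_nonsing_inv _ hdet, Matrix.nonsing_inv_mul _ hdet, ?_⟩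
  by_contra hcon
  push Not at hcon
  apply hv ((P⁻¹ * M * P) 0 0)
  have e1 : (P⁻¹ * M * P) *ᵥ (Pi.single 0 1) = ((P⁻¹ * M * P) 0 0) • (Pi.single 0 1) := by
    ext j
    refine Fin.cases ?_ (fun j => ?_) j
    · simp
    · simp [hcon j]
  have e2 := congrArg (fun x => P *ᵥ x) e1
  simp only [Matrix.mulVec_smul, hcol, Matrix.mulVec_mulVec] at e2
  rw [← e2, ← Matrix.mul_assoc, ← Matrix.mul_assoc, Matrix.mul_nonsing_inv _ hdet, Matrix.one_mul,
    ← Matrix.mulVec_mulVec, hcol]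

/-- choice of the row -/
lemma exists_row {K : Type} [Field K] {n : ℕ} (c : Fin n → K) (D : Matrix (Fin n) (Fin n) K)
    (i : Fin n) (hi : c i ≠ 0) (t : K) :
    ∃ w : Fin n → K, w ⬝ᵥ c = t ∧
      (n ≤ 1 ∨ ¬ ∃ x : K, Matrix.vecMulVec c w + D = x • (1 : Matrix (Fin n) (Fin n) K)) := by
  let w1 : Fin n → K := Pi.single i (t / c i)
  have hw1 : w1 ⬝ᵥ c = t := by simp [w1, hi]
  by_cases hn : n ≤ 1
  · exact ⟨w1, hw1, Or.inl hn⟩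
  by_cases h1 : ∃ x : K, Matrix.vecMulVec c w1 + D = x • (1 : Matrix (Fin n) (Fin n) K)
  swap
  · exact ⟨w1, hw1, Or.inr h1⟩
  obtain ⟨x, hx⟩ := h1
  have : Nontrivial (Fin n) := Fin.nontrivial_iff_two_le.2 (by omega)
  obtain ⟨j, hj⟩ := exists_ne i
  let u : Fin n → K := Pi.single j (c i) - Pi.single i (c j)
  refine ⟨w1 + u, ?_, Or.inr ?_⟩
  · rw [add_dotProduct, hw1]
    simp [u, sub_dotProduct, mul_comm]
  · rintro ⟨y, hy⟩
    rw [Matrix.vecMulVec_add, add_right_comm, hx] at hy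
    have := congrFun (congrFun hy i) j
    simp [Matrix.vecMulVec_apply, u, hj, Ne.symm hj, hi] at this

theorem good_diag {K : Type} [Field K] (n : ℕ) : ∀ (M : Matrix (Fin n) (Fin n) K) (d : Fin n → K),
    (n ≤ 1 ∨ ¬ ∃ c : K, M = c • (1 : Matrix (Fin n) (Fin n) K)) → ∑ i, d i = M.trace →
    GoodDiag M d := by
  induction n with
  | zero => exact fun M d _ _ => ⟨1, 1, by simp, by simp, fun i => i.elim0⟩
  | succ n ih =>
    intro M d h htr
    rcases Nat.eq_zero_or_pos n with rfl | hn
    · refine ⟨1, 1, by simp, by simp, fun i => ?_⟩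
      have : i = 0 := Fin.ext (by omega)
      subst this
      simpa [Matrix.trace] using htr.symm
    have h := h.resolve_left (by omega)
    obtain ⟨P, Q, hPQ, hQP, i, hi⟩ := exists_conj M h
    apply GoodDiag.sim hPQ hQP
    have htr2 : ∑ i, d i = (Q * M * P).trace := by
      rw [htr, Matrix.trace_mul_comm, ← Matrix.mul_assoc, hPQ, Matrix.one_mul]
    generalize Q * M * P = N at hi htr2
    let e : Unit ⊕ Fin n ≃ Fin (n+1) :=
      { toFun := Sum.elim (fun _ => 0) Fin.succ
        invFun := Fin.cases (Sum.inl ()) Sum.inr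
        left_inv := by rintro (_ | i) <;> simp
        right_inv := by intro i; refine Fin.cases ?_ (fun i => ?_) i <;> simp }
    apply GoodDiag.equiv e
    let c : Fin n → K := fun j => N j.succ 0
    let r : Fin n → K := fun j => N 0 j.succ
    let D : Matrix (Fin n) (Fin n) K := fun a b => N a.succ b.succ
    obtain ⟨w, hw, hns⟩ := exists_row c D i hi (N 0 0 - d 0)
    have hN : N.submatrix e e = fromBlocks (of fun _ _ => N 0 0) (replicateRow Unit r) (replicateCol Unit c) D := by
      ext a b
      rcases a with a | a <;> rcases b with b | b <;> rfl
    rw [hN]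
    have hD : GoodDiag (Matrix.vecMulVec c w + D) (fun j => d j.succ) := by
      apply ih _ _ hns
      rw [Fin.sum_univ_succ] at htr2
      rw [Matrix.trace_add, Matrix.trace_vecMulVec, dotProduct_comm, hw]
      have : N.trace = N 0 0 + D.trace := by
        simp only [Matrix.trace, Fin.sum_univ_succ]
        rfl
      rw [this] at htr2
      linear_combination htr2
    obtain ⟨R, S, hRS, hSR, hdiag⟩ := hD
    apply GoodDiag.sim (P := fromBlocks 1 (replicateRow Unit w) 0 1) (Q := fromBlocks 1 (-replicateRow Unit w) 0 1)
    · simp [fromBlocks_multiply]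
    · simp [fromBlocks_multiply]
    refine ⟨fromBlocks 1 0 0 R, fromBlocks 1 0 0 S, ?_, ?_, ?_⟩
    · simp [fromBlocks_multiply, hRS]
    · simp [fromBlocks_multiply, hSR]
    · rintro (a | a)
      · simp only [fromBlocks_multiply, fromBlocks_apply₁₁]
        have : (replicateRow Unit w * replicateCol Unit c) () () = N 0 0 - d 0 := by
          rw [← hw]; rfl
        simp [this, e]
      · have e2 : d (e (Sum.inr a)) = (S * (vecMulVec c w + D) * R) a a := (hdiag a).symm
        rw [Function.comp_apply, e2]
        simp only [fromBlocks_multiply, fromBlocks_apply₂₂]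
        have : replicateCol Unit c * replicateRow Unit w = vecMulVec c w := by
          ext a b; simp [Matrix.mul_apply, vecMulVec_apply]
        simp [this]

lemma nonscalar_case (p : ℕ) [Fact p.Prime] (k n : ℕ)
    (hd : p > Nat.gcd k (p - 1) + 1) (hpk : ¬ p ∣ k) (h1 : p ≤ 2 * n)
    (M : Matrix (Fin n) (Fin n) (ZMod p))
    (hM : ¬ ∃ c : ZMod p, M = c • (1 : Matrix (Fin n) (Fin n) (ZMod p))) :
    ∃ A B : Matrix (Fin n) (Fin n) (ZMod p), IsUnit A ∧ IsUnit B ∧ M = A ^ k + B ^ k := by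
  classical
  have hp := (Fact.out : p.Prime)
  obtain ⟨g, hg⟩ := IsCyclic.exists_generator (α := (ZMod p)ˣ)
  have hgo : orderOf g = p - 1 := by
    rw [orderOf_eq_card_of_forall_mem_zpowers hg, Nat.card_eq_fintype_card, ZMod.card_units]
  have hgk : g ^ k ≠ 1 := by
    intro h
    have := orderOf_dvd_of_pow_eq_one h
    rw [hgo] at this
    rw [Nat.gcd_eq_right this] at hd
    omega
  set h : ZMod p := (g : ZMod p) ^ k with hh
  have hne : h - 1 ≠ 0 := by
    intro h0
    apply hgk
    apply Units.ext
    push_cast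
    exact sub_eq_zero.1 h0
  have hh0 : h ≠ 0 := pow_ne_zero _ g.ne_zero
  set j : ℕ := ((M.trace - 2 * n) / (h - 1)).val with hj
  have hjlt : j < p := ZMod.val_lt _
  have hjc : (j : ZMod p) * (h - 1) = M.trace - 2 * n := by
    rw [hj, ZMod.natCast_val, ZMod.cast_id]
    field_simp
  let f : ℕ → Fin n → ZMod p := fun m i => if (i : ℕ) < m then h else 1
  have hf : ∀ m, m ≤ n → ∑ i, f m i = n + m * (h - 1) := by
    intro m hm
    have e : ∀ i : Fin n, f m i = 1 + (if (i:ℕ) < m then h - 1 else 0) := by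
      intro i; simp only [f]; split_ifs <;> ring
    simp only [e]
    rw [Finset.sum_add_distrib, Fin.sum_univ_eq_sum_range (fun i => if i < m then h - 1 else 0) n,
      ← Finset.sum_filter]
    have : (Finset.range n).filter (fun i => i < m) = Finset.range m := by
      ext i; simp; omega
    rw [this]; simp [mul_sub]
  have hfp : ∀ m i, f m i ≠ 0 ∧ ∃ c, c ^ k = f m i := by
    intro m i
    simp only [f]; split_ifs
    · exact ⟨hh0, g, rfl⟩
    · exact ⟨one_ne_zero, 1, one_pow _⟩
  set a := min j n with ha
  set b := j - a with hb
  have hab : a + b = j := by omega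
  obtain ⟨P, Q, hPQ, hQP, hdiag⟩ := good_diag n M (fun i => f a i + f b i) (Or.inr hM) (by
    rw [Finset.sum_add_distrib, hf a (by omega), hf b (by omega)]
    have : (j : ZMod p) = a + b := by rw [← hab]; push_cast; rfl
    rw [this] at hjc
    linear_combination hjc)
  set N := Q * M * P with hN
  let L : Matrix (Fin n) (Fin n) (ZMod p) := fun x y => if y < x then N x y else if x = y then f a x else 0
  let U : Matrix (Fin n) (Fin n) (ZMod p) := fun x y => if x < y then N x y else if x = y then f b x else 0
  have hLU : N = L + U := by
    ext x y
    rw [Matrix.add_apply]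
    simp only [L, U]
    rcases lt_trichotomy x y with hxy | hxy | hxy
    · simp [hxy, hxy.not_gt, hxy.ne]
    · subst hxy; simp [hdiag x]
    · simp [hxy, hxy.not_gt, hxy.ne']
  obtain ⟨A, hA, hAk⟩ := root_lower (k := k) hpk L (by
    intro x y hxy
    simp only [id] at hxy
    change L y x = 0
    simp [L, hxy.not_gt, hxy.ne]) (by intro i; simpa [L] using hfp a i)
  obtain ⟨B, hB, hBk⟩ := root_upper (k := k) hpk U (by
    intro x y hxy
    simp only [id] at hxy
    simp [U, hxy.not_gt, hxy.ne']) (by intro i; simpa [U] using hfp b i)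
  let u : (Matrix (Fin n) (Fin n) (ZMod p))ˣ := ⟨P, Q, hPQ, hQP⟩
  have hconj : ∀ X : Matrix (Fin n) (Fin n) (ZMod p), (P * X * Q) ^ k = P * X ^ k * Q := by
    intro X
    exact Units.conj_pow u X k
  refine ⟨P * A * Q, P * B * Q, (u.isUnit.mul hA).mul u⁻¹.isUnit, (u.isUnit.mul hB).mul u⁻¹.isUnit, ?_⟩
  rw [hconj, hconj, hAk, hBk, ← add_mul, ← mul_add, ← hLU, hN]
  rw [show P * (Q * M * P) * Q = (P * Q) * M * (P * Q) by simp only [Matrix.mul_assoc], hPQ]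
  simp

lemma gcd_pow_to_pow {F : Type*} [Field F] [Fintype F] (k : ℕ) (a : F) (ha : a ≠ 0) :
    ∃ b : F, b ≠ 0 ∧ b ^ k = a ^ Nat.gcd k (Fintype.card F - 1) := by
  have h := Nat.gcd_eq_gcd_ab k (Fintype.card F - 1)
  refine ⟨a ^ (Nat.gcdA k (Fintype.card F - 1)), zpow_ne_zero _ ha, ?_⟩
  rw [← zpow_natCast a, h, zpow_add₀ ha, _root_.zpow_mul a ((Fintype.card F - 1 : ℕ) : ℤ), zpow_natCast,
    FiniteField.pow_card_sub_one_eq_one a ha, _root_.one_zpow, mul_one, ← zpow_natCast, ← _root_.zpow_mul, mul_comm]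

lemma neg_one_pow {F : Type*} [Field F] [Fintype F] (k : ℕ) (hk : 1 ≤ k)
    (he : Even ((Fintype.card F - 1) / Nat.gcd k (Fintype.card F - 1))) :
    ∃ b : F, b ≠ 0 ∧ b ^ k = -1 := by
  classical
  set d := Nat.gcd k (Fintype.card F - 1) with hd
  have hd0 : 0 < d := Nat.gcd_pos_of_pos_left _ hk
  obtain ⟨m, hm⟩ : d ∣ Fintype.card F - 1 := Nat.gcd_dvd_right _ _
  rw [hm, Nat.mul_div_cancel_left _ hd0] at he
  obtain ⟨g, hg⟩ := IsCyclic.exists_generator (α := Fˣ)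
  have hgo : orderOf g = Fintype.card F - 1 := by
    rw [orderOf_eq_card_of_forall_mem_zpowers hg, Nat.card_eq_fintype_card, Fintype.card_units]
  obtain ⟨t, ht⟩ := (mem_powers_iff_mem_zpowers (x := g)).2 (hg (-1))
  simp only at ht
  have h1 : g ^ (t * m) = 1 := by rw [pow_mul, ht, he.neg_one_pow]
  have h2 := orderOf_dvd_of_pow_eq_one h1
  rw [hgo, hm] at h2
  have hc := Fintype.one_lt_card (α := F)
  have hm0 : 0 < m := by
    rcases Nat.eq_zero_or_pos m with rfl | h
    · omega
    · exact h
  obtain ⟨x, rfl⟩ := Nat.dvd_of_mul_dvd_mul_right hm0 h2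
  obtain ⟨b, hb, hb'⟩ := gcd_pow_to_pow k ((g : F) ^ x) (pow_ne_zero _ g.ne_zero)
  refine ⟨b, hb, ?_⟩
  rw [hb', ← hd, ← pow_mul, mul_comm]
  have := congrArg Units.val ht
  simpa using this

theorem stmt14 (p : ℕ) [Fact p.Prime] (k n : ℕ) (hk : 1 ≤ k) (hn : 2 ≤ n)
    (hd : p > Nat.gcd k (p - 1) + 1) (hpk : ¬ p ∣ k)
    (h1 : n > (p - 1) / 2) :
    (p ^ n > (k - 1) ^ 4 →
      ∀ M : Matrix (Fin n) (Fin n) (ZMod p), ∃ A B : Matrix (Fin n) (Fin n) (ZMod p),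
        M = A ^ k + B ^ k) ∧
    (p ^ n > (k - 1) ^ 4 + 4 * k → Even (p * ((p ^ n - 1) / Nat.gcd k (p ^ n - 1))) →
      ∀ M : Matrix (Fin n) (Fin n) (ZMod p), ∃ A B : Matrix (Fin n) (Fin n) (ZMod p),
        IsUnit A ∧ IsUnit B ∧ M = A ^ k + B ^ k) := by
  have hp := (Fact.out : p.Prime)
  have hg0 : 0 < Nat.gcd k (p - 1) := Nat.gcd_pos_of_pos_left _ hk
  have hp3 : 3 ≤ p := by omega
  have hpodd : Odd p := hp.odd_of_ne_two (by omega)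
  have hnon := nonscalar_case p k n hd hpk (by omega)
  letI : Fintype (GaloisField p n) := Fintype.ofFinite _
  have hcard : Fintype.card (GaloisField p n) = p ^ n := by
    rw [← Nat.card_eq_fintype_card, GaloisField.card p n (by omega)]
  have h9 : 9 ≤ p ^ n := by
    calc 9 = 3 ^ 2 := by norm_num
      _ ≤ p ^ 2 := Nat.pow_le_pow_left hp3 2
      _ ≤ p ^ n := Nat.pow_le_pow_right (by omega) hn
  let bas : Module.Basis (Fin n) (ZMod p) (GaloisField p n) :=
    Module.finBasisOfFinrankEq (ZMod p) (GaloisField p n) (GaloisField.finrank p (by omega))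
  let φ : GaloisField p n →ₐ[ZMod p] Matrix (Fin n) (Fin n) (ZMod p) := Algebra.leftMulMatrix bas
  have hsc : ∀ c : ZMod p, (∃ a b : GaloisField p n, a ≠ 0 ∧ b ≠ 0 ∧ a ^ k + b ^ k = algebraMap _ _ c) →
      ∃ A B : Matrix (Fin n) (Fin n) (ZMod p), IsUnit A ∧ IsUnit B ∧
        c • (1 : Matrix (Fin n) (Fin n) (ZMod p)) = A ^ k + B ^ k := by
    rintro c ⟨a, b, ha, hb, hab⟩
    refine ⟨φ a, φ b, (Ne.isUnit ha).map φ, (Ne.isUnit hb).map φ, ?_⟩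
    rw [← map_pow, ← map_pow, ← map_add, hab, AlgHom.commutes, Algebra.algebraMap_eq_smul_one]
  have hsc' : p ^ n > (k - 1) ^ 4 → ∀ c : ZMod p, c ≠ 0 →
      ∃ A B : Matrix (Fin n) (Fin n) (ZMod p), IsUnit A ∧ IsUnit B ∧
        c • (1 : Matrix (Fin n) (Fin n) (ZMod p)) = A ^ k + B ^ k := by
    intro hq c hc
    apply hsc
    set d := Nat.gcd k (Fintype.card (GaloisField p n) - 1) with hdd
    have hdk : d ≤ k := Nat.gcd_le_left _ hk
    obtain ⟨a, b, ha, hb, hab⟩ := fermat (F := GaloisField p n) d (Nat.gcd_pos_of_pos_left _ hk)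
      (Nat.gcd_dvd_right _ _) (by omega)
      (by rw [hcard]; exact lt_of_le_of_lt (Nat.pow_le_pow_left (by omega) 4) hq)
      (algebraMap (ZMod p) (GaloisField p n) c)
      (by rwa [Ne, FaithfulSMul.algebraMap_eq_zero_iff])
    obtain ⟨a', ha', ha2⟩ := gcd_pow_to_pow k a ha
    obtain ⟨b', hb', hb2⟩ := gcd_pow_to_pow k b hb
    exact ⟨a', b', ha', hb', by rw [ha2, hb2, hab]⟩
  constructor
  · intro hq M
    by_cases hM : ∃ c : ZMod p, M = c • (1 : Matrix (Fin n) (Fin n) (ZMod p))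
    · obtain ⟨c, rfl⟩ := hM
      by_cases hc : c = 0
      · exact ⟨0, 0, by simp [hc, show k ≠ 0 by omega]⟩
      · obtain ⟨A, B, _, _, h⟩ := hsc' hq c hc
        exact ⟨A, B, h⟩
    · obtain ⟨A, B, _, _, h⟩ := hnon M hM
      exact ⟨A, B, h⟩
  · intro hq hev M
    by_cases hM : ∃ c : ZMod p, M = c • (1 : Matrix (Fin n) (Fin n) (ZMod p))
    · obtain ⟨c, rfl⟩ := hM
      by_cases hc : c = 0
      · apply hsc
        rw [Nat.even_mul] at hev
        have hev := hev.resolve_left (Nat.not_even_iff_odd.2 hpodd)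
        rw [← hcard] at hev
        obtain ⟨b, hb, hb'⟩ := neg_one_pow (F := GaloisField p n) k hk hev
        exact ⟨1, b, one_ne_zero, hb, by simp [hb', hc]⟩
      · exact hsc' (by omega) c hc
    · exact hnon M hM
end
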